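/- arXiv:2210.07326 — 7 statements merged into one kernel-verified Lean document; each statement's English description precedes it below -/
import Mathlib

section
/- Let q_p ∈ ℝ and c_p > 0, and let Ω be the left parabolic region Ω = {x + iy ∈ ℂ : y² < (2/c_p)·(q_p − x)}. A real n×n matrix A has all of its complex eigenvalues in Ω if and only if A = (J − R)Q for some real n×n matrices J, R, Q with Jᵀ = −J, Rᵀ = R, Q symmetric positive definite, and such that the real symmetric 2n×2n block matrix [[Q⁻¹, −√(c_p/2)·J], [√(c_p/2)·J, q_p·Q⁻¹ + R]] is positive definite. -/
open Matrix

/-- Every endomorphism of a finite-dimensional complex space is arbitrarily close to a diagonal one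
in a suitable basis, with eigenvalues on the diagonal. -/
theorem Module.End.exists_basis_near_diagonal {V : Type*} [AddCommGroup V] [Module ℂ V]
    [FiniteDimensional ℂ V] (f : Module.End ℂ V) {n : ℕ} (hn : Module.finrank ℂ V = n) :
    ∃ d : Fin n → ℂ, (∀ i, f.HasEigenvalue (d i)) ∧ ∀ ε > 0, ∃ b : Module.Basis (Fin n) ℂ V,
      ∀ i j, ‖b.repr (f (b i) - d i • b i) j‖ ≤ ε := by
  induction n generalizing V with
  | zero => exact ⟨Fin.elim0, fun i => i.elim0, fun ε _ =>
      ⟨Module.finBasisOfFinrankEq ℂ V hn, fun i => i.elim0⟩⟩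
  | succ n ih =>
    have : Nontrivial V := Module.nontrivial_of_finrank_pos (R := ℂ) (by omega)
    obtain ⟨c, hc⟩ := Module.End.exists_eigenvalue f
    have hlt : LinearMap.range (f - algebraMap ℂ (Module.End ℂ V) c) < ⊤ := by
      rw [lt_top_iff_ne_top, Ne, ← LinearMap.ker_eq_bot_iff_range_eq_top]
      rw [Module.End.hasEigenvalue_iff, Module.End.eigenspace_def] at hc
      exact hc
    obtain ⟨φ, hφ0, hφ⟩ := Submodule.exists_le_ker_of_lt_top _ hlt
    have hφf (v : V) : φ (f v) = c * φ v := by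
      have : φ (f v - c • v) = 0 := hφ ⟨v, by simp⟩
      simpa [sub_eq_zero] using this
    have hmaps : ∀ x ∈ LinearMap.ker φ, f x ∈ LinearMap.ker φ := by
      intro x hx
      simp_all
    have hfr : Module.finrank ℂ (LinearMap.ker φ) = n := by
      have := Module.Dual.finrank_ker_add_one_of_ne_zero hφ0
      omega
    obtain ⟨d, hd, hb⟩ := ih (f.restrict hmaps) hfr
    obtain ⟨v, hv⟩ : ∃ v, φ v ≠ 0 := by
      by_contra! h
      exact hφ0 (LinearMap.ext h)
    refine ⟨Fin.cons c d, fun i => ?_, fun ε hε => ?_⟩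
    · refine Fin.cases hc (fun i => ?_) i
      obtain ⟨x, hx⟩ := (hd i).exists_hasEigenvector
      refine Module.End.hasEigenvalue_of_hasEigenvector (x := (x : V))
        (Module.End.hasEigenvector_iff.2 ⟨?_, by simpa using hx.2⟩)
      rw [Module.End.mem_eigenspace_iff]
      simpa using congrArg Subtype.val hx.apply_eq_smul
    obtain ⟨b, hb⟩ := hb ε hε
    let w : LinearMap.ker φ := ⟨f v - c • v, by simp [hφf]⟩
    obtain ⟨t, ht0, ht⟩ : ∃ t : ℝ, 0 < t ∧ ∀ j, t * ‖b.repr w j‖ ≤ ε := by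
      refine ⟨ε / (1 + ∑ j, ‖b.repr w j‖), by positivity, fun j => ?_⟩
      rw [div_mul_eq_mul_div, div_le_iff₀ (by positivity)]
      gcongr
      exact (Finset.single_le_sum (fun i _ => norm_nonneg (b.repr w i)) (Finset.mem_univ j)).trans
        (by linarith)
    have ht' : (t : ℂ) ≠ 0 := by exact_mod_cast ht0.ne'
    let B : Module.Basis (Fin (n + 1)) ℂ V := Module.Basis.mkFinCons ((t : ℂ) • v) b
      (fun a x hx h => by
        have := congrArg φ h
        simpa [LinearMap.mem_ker.1 hx, hv, ht'] using this)
      (fun z => ⟨-(φ z / (t * φ v)), by simp; field_simp; ring⟩)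
    have hB0 : B 0 = (t : ℂ) • v := by simp [B]
    have hBs (i : Fin n) : B i.succ = b i := by simp [B]
    have hrepr (x : LinearMap.ker φ) : ⇑(B.repr x) = Fin.cons 0 (b.repr x) := by
      have : (x : V) = ∑ i, (Fin.cons 0 (b.repr x) : Fin (n + 1) → ℂ) i • B i := by
        conv_lhs => rw [← b.sum_repr x]
        simp [Fin.sum_univ_succ, hBs, -Module.Basis.sum_repr]
      rw [this, B.repr_sum_self]
    refine ⟨B, fun i => Fin.cases (fun j => ?_) (fun i j => ?_) i⟩
    · have : f (B 0) - c • B 0 = (((t : ℂ) • w : LinearMap.ker φ) : V) := by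
        simp [hB0, w, smul_sub, smul_comm c]
      rw [Fin.cons_zero, this, hrepr]
      refine Fin.cases (by simpa using hε.le) (fun j => ?_) j
      simpa only [Fin.cons_succ, map_smul, Finsupp.smul_apply, norm_smul, Complex.norm_real,
        Real.norm_of_nonneg ht0.le] using ht j
    · have : f (B i.succ) - d i • B i.succ =
          ((f.restrict hmaps (b i) - d i • b i : LinearMap.ker φ) : V) := by
        simp [hBs]
      rw [Fin.cons_succ, this, hrepr]
      refine Fin.cases (by simpa using hε.le) (fun j => ?_) j
      simpa using hb i j

/-- Every complex matrix is similar to arbitrarily small perturbations of a diagonal matrix. -/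
theorem Matrix.exists_near_diagonal {n : ℕ} (A : Matrix (Fin n) (Fin n) ℂ) :
    ∃ d : Fin n → ℂ, (∀ i, A.charpoly.IsRoot (d i)) ∧ ∀ ε > 0, ∃ T E : Matrix (Fin n) (Fin n) ℂ,
      IsUnit T ∧ A * T = T * (diagonal d + E) ∧ ∀ i j, ‖E i j‖ ≤ ε := by
  obtain ⟨d, hd, h⟩ := Module.End.exists_basis_near_diagonal (Matrix.toLin' A) (n := n) (by simp)
  refine ⟨d, fun i => ?_, fun ε hε => ?_⟩
  · have := (Module.End.hasEigenvalue_iff_isRoot_charpoly _ _).1 (hd i)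
    simpa [Matrix.charpoly_toLin'] using this
  obtain ⟨b, hb⟩ := h ε hε
  let T : Matrix (Fin n) (Fin n) ℂ := .of fun i j => b j i
  let E : Matrix (Fin n) (Fin n) ℂ := .of fun i j => b.repr (A *ᵥ b j - d j • b j) i
  refine ⟨T, E, ?_, ?_, fun i j => by simpa [E] using hb j i⟩
  · have hT : T = (Pi.basisFun ℂ (Fin n)).toMatrix b := by
      ext
      simp [T, Module.Basis.toMatrix_apply]
    let := (Pi.basisFun ℂ (Fin n)).invertibleToMatrix b
    rw [hT]
    exact isUnit_of_invertible _
  · ext i j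
    have := congrFun (b.sum_repr (A *ᵥ b j - d j • b j)) i
    simp only [Finset.sum_apply, Pi.smul_apply, smul_eq_mul, Pi.sub_apply] at this
    rw [mul_add, add_apply, mul_diagonal, mul_apply, mul_apply]
    simp only [T, E, of_apply]
    rw [Finset.sum_congr rfl fun k _ => mul_comm (b k i) _, this]
    simp [mulVec, dotProduct, mul_comm]

/-- The quadratic form of the block matrix of a left parabolic region. -/
theorem parabola_block_quadratic {n : ℕ} (s q : ℝ) {P J R : Matrix (Fin n) (Fin n) ℝ}
    (hJ : Jᵀ = -J) (f g : Fin n → ℝ) :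
    Sum.elim f g ⬝ᵥ (fromBlocks P (-s • J) (s • J) (q • P + R) *ᵥ Sum.elim f g) =
      f ⬝ᵥ P *ᵥ f + 2 * s * (g ⬝ᵥ J *ᵥ f) + q * (g ⬝ᵥ P *ᵥ g) + g ⬝ᵥ R *ᵥ g := by
  have h : f ⬝ᵥ J *ᵥ g = -(g ⬝ᵥ J *ᵥ f) := by
    rw [← dotProduct_transpose_mulVec, hJ, neg_mulVec, dotProduct_neg]
  simp only [fromBlocks_mulVec, sumElim_dotProduct_sumElim, Sum.elim_comp_inl, Sum.elim_comp_inr,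
    add_mulVec, smul_mulVec, dotProduct_add, dotProduct_smul, smul_eq_mul, h]
  ring

theorem parabola_block_isHermitian {n : ℕ} (s q : ℝ) {P J R : Matrix (Fin n) (Fin n) ℝ}
    (hP : Pᵀ = P) (hJ : Jᵀ = -J) (hR : Rᵀ = R) :
    (fromBlocks P (-s • J) (s • J) (q • P + R)).IsHermitian := by
  rw [IsHermitian, conjTranspose_eq_transpose_of_trivial, fromBlocks_transpose]
  simp only [transpose_smul, transpose_add, transpose_neg, hP, hR, hJ, smul_neg, neg_smul, neg_neg]

/-- If `A P = J - R` and the block matrix is positive definite, the eigenvalues of `A` lie in the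
left parabolic region. -/
theorem root_mem_parabola {n : ℕ} {q k : ℝ} (hk : 0 < k) {A J R P : Matrix (Fin n) (Fin n) ℝ}
    (hJ : Jᵀ = -J) (hR : Rᵀ = R) (hP : P.PosDef) (hA : A * P = J - R)
    (hB : (fromBlocks P (-(√k) • J) (√k • J) (q • P + R)).PosDef) {z : ℂ}
    (hz : (A.map Complex.ofReal).charpoly.IsRoot z) : k * z.im ^ 2 < q - z.re := by
  have hev : Module.End.HasEigenvalue (toLin' (A.map Complex.ofReal)) z := by
    rw [Module.End.hasEigenvalue_iff_isRoot_charpoly, Matrix.charpoly_toLin']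
    exact hz
  obtain ⟨v, hv⟩ := hev.exists_hasEigenvector
  have hv0 := hv.2
  have hvA := hv.apply_eq_smul
  rw [toLin'_apply] at hvA
  obtain ⟨a, ha⟩ : ∃ a, P *ᵥ a = fun i => (v i).re :=
    (mulVec_surjective_iff_isUnit.2 hP.isUnit) _
  obtain ⟨b, hb⟩ : ∃ b, P *ᵥ b = fun i => (v i).im :=
    (mulVec_surjective_iff_isUnit.2 hP.isUnit) _
  have hab : a ≠ 0 ∨ b ≠ 0 := by
    by_contra! h
    refine hv0 (funext fun i => Complex.ext ?_ ?_)
    · simpa [h.1] using (congrFun ha i).symm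
    · simpa [h.2] using (congrFun hb i).symm
  have hre : J *ᵥ a - R *ᵥ a = z.re • P *ᵥ a - z.im • P *ᵥ b := by
    rw [← sub_mulVec, ← hA, ← mulVec_mulVec, ha, hb]
    funext i
    simpa [mulVec, dotProduct] using congrArg Complex.re (congrFun hvA i)
  have him : J *ᵥ b - R *ᵥ b = z.re • P *ᵥ b + z.im • P *ᵥ a := by
    rw [← sub_mulVec, ← hA, ← mulVec_mulVec, ha, hb]
    funext i
    simpa [mulVec, dotProduct] using congrArg Complex.im (congrFun hvA i)
  have hk2 : √k * √k = k := Real.mul_self_sqrt hk.le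
  have hPs : b ⬝ᵥ P *ᵥ a = a ⬝ᵥ P *ᵥ b := by
    rw [← dotProduct_transpose_mulVec, (conjTranspose_eq_transpose_of_trivial P).symm.trans hP.1]
  have hRs : b ⬝ᵥ R *ᵥ a = a ⬝ᵥ R *ᵥ b := by
    rw [← dotProduct_transpose_mulVec, hR]
  have hJs (x y : Fin n → ℝ) : y ⬝ᵥ J *ᵥ x = -(x ⬝ᵥ J *ᵥ y) := by
    rw [← dotProduct_transpose_mulVec, hJ, neg_mulVec, dotProduct_neg]
  have h1 := congrArg (a ⬝ᵥ ·) hre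
  have h2 := congrArg (b ⬝ᵥ ·) hre
  have h3 := congrArg (a ⬝ᵥ ·) him
  have h4 := congrArg (b ⬝ᵥ ·) him
  simp only [dotProduct_sub, dotProduct_add, dotProduct_smul, smul_eq_mul] at h1 h2 h3 h4
  have hpos (f g : Fin n → ℝ) : 0 ≤ f ⬝ᵥ P *ᵥ f + 2 * √k * (g ⬝ᵥ J *ᵥ f) +
      q * (g ⬝ᵥ P *ᵥ g) + g ⬝ᵥ R *ᵥ g ∧ (g ≠ 0 → 0 < f ⬝ᵥ P *ᵥ f + 2 * √k * (g ⬝ᵥ J *ᵥ f) +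
      q * (g ⬝ᵥ P *ᵥ g) + g ⬝ᵥ R *ᵥ g) := by
    rw [← parabola_block_quadratic _ _ hJ]
    refine ⟨by simpa using hB.posSemidef.dotProduct_mulVec_nonneg (Sum.elim f g), fun hg => ?_⟩
    have := hB.dotProduct_mulVec_pos (x := Sum.elim f g)
      (fun h => hg (funext fun i => congrFun h (Sum.inr i)))
    simpa using this
  have hX : 0 ≤ a ⬝ᵥ P *ᵥ a := by simpa using hP.posSemidef.dotProduct_mulVec_nonneg a
  have hY : 0 ≤ b ⬝ᵥ P *ᵥ b := by simpa using hP.posSemidef.dotProduct_mulVec_nonneg b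
  have e1 := hpos (-(z.im * √k) • b) a
  have e2 := hpos ((z.im * √k) • a) b
  simp only [mulVec_smul, smul_dotProduct, dotProduct_smul, smul_eq_mul] at e1 e2
  have hsum : 0 < (q - z.re - k * z.im ^ 2) * (a ⬝ᵥ P *ᵥ a + b ⬝ᵥ P *ᵥ b) := by
    have := hab.elim (fun h => add_pos_of_pos_of_nonneg (e1.2 h) e2.1)
      (fun h => add_pos_of_nonneg_of_pos e1.1 (e2.2 h))
    refine this.trans_eq ?_
    rw [hJs a b]
    rw [hJs a b, hRs, hPs] at h2
    rw [hPs] at h4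
    linear_combination (z.im ^ 2 * (a ⬝ᵥ P *ᵥ a + b ⬝ᵥ P *ᵥ b) - 4 * z.im * (a ⬝ᵥ J *ᵥ b)) * hk2 -
      2 * k * z.im * (h3 - h2) - (h1 + h4) + (hJs a a + hJs b b) / 2
  have := pos_of_mul_pos_left hsum (add_nonneg hX hY)
  linarith

theorem Matrix.dotProduct_map_re_mulVec {n : ℕ} (M : Matrix (Fin n) (Fin n) ℂ) (f g : Fin n → ℝ) :
    g ⬝ᵥ M.map Complex.re *ᵥ f =
      (star (fun i => (g i : ℂ)) ⬝ᵥ M *ᵥ (fun i => (f i : ℂ))).re := by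
  simp [dotProduct, mulVec, Complex.re_sum]

theorem dotProduct_diagonal_add_mulVec {n : ℕ} (d : Fin n → ℂ) (E : Matrix (Fin n) (Fin n) ℂ)
    (x y : Fin n → ℂ) : star x ⬝ᵥ (diagonal d + E) *ᵥ y =
      ∑ i, star (x i) * (d i * y i) + ∑ i, ∑ j, star (x i) * (E i j * y j) := by
  rw [add_mulVec, dotProduct_add]
  congr 1
  · simp [dotProduct, mulVec_diagonal]
  · simp [dotProduct, mulVec, Finset.mul_sum]

theorem norm_sum_star_mul_mul_le {n : ℕ} {E : Matrix (Fin n) (Fin n) ℂ} {ε : ℝ}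
    (hE : ∀ i j, ‖E i j‖ ≤ ε) (x y : Fin n → ℂ) :
    ‖∑ i, ∑ j, star (x i) * (E i j * y j)‖ ≤ ε * n * ((∑ i, ‖x i‖ ^ 2 + ∑ i, ‖y i‖ ^ 2) / 2) := by
  calc ‖∑ i, ∑ j, star (x i) * (E i j * y j)‖
      ≤ ∑ i, ∑ j, ‖star (x i) * (E i j * y j)‖ :=
        (norm_sum_le _ _).trans (Finset.sum_le_sum fun i _ => norm_sum_le _ _)
    _ ≤ ∑ i, ∑ j, ε * ((‖x i‖ ^ 2 + ‖y j‖ ^ 2) / 2) := by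
        gcongr with i _ j _
        rw [norm_mul, norm_mul, norm_star, mul_left_comm]
        have := two_mul_le_add_sq ‖x i‖ ‖y j‖
        exact mul_le_mul (hE i j) (by linarith) (by positivity) ((norm_nonneg _).trans (hE i j))
    _ = ε * n * ((∑ i, ‖x i‖ ^ 2 + ∑ i, ‖y i‖ ^ 2) / 2) := by
        simp only [← Finset.mul_sum, ← Finset.sum_div, Finset.sum_add_distrib, Finset.sum_const,
          Finset.card_univ, Fintype.card_fin, nsmul_eq_mul]
        ring

/-- A uniform lower bound for the scalar version of the block quadratic form. -/
theorem exists_parabola_gap {k q : ℝ} (hk : 0 ≤ k) {z : ℂ} (hz : k * z.im ^ 2 < q - z.re) :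
    ∃ δ > 0, ∀ a b : ℂ, δ * (‖a‖ ^ 2 + ‖b‖ ^ 2) ≤ ‖a‖ ^ 2 +
      √k * (star b * (z * a) - star a * (z * b)).re + q * ‖b‖ ^ 2 - (star b * (z * b)).re := by
  have hk2 : √k ^ 2 = k := Real.sq_sqrt hk
  obtain ⟨δ, hδ, hδ1, h⟩ : ∃ δ : ℝ, 0 < δ ∧ δ < 1 ∧ k * z.im ^ 2 ≤ (1 - δ) * (q - z.re - δ) := by
    have hc : Filter.Tendsto (fun δ : ℝ => (1 - δ) * (q - z.re - δ)) (nhdsWithin 0 (Set.Ioi 0))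
        (nhds (q - z.re)) := by
      have : Continuous fun δ : ℝ => (1 - δ) * (q - z.re - δ) := by fun_prop
      simpa using (this.tendsto 0).mono_left nhdsWithin_le_nhds
    obtain ⟨δ, h, h1⟩ := ((hc.eventually (lt_mem_nhds hz)).and
      (Ioo_mem_nhdsGT (zero_lt_one' ℝ))).exists
    exact ⟨δ, h1.1, h1.2, h.le⟩
  refine ⟨δ, hδ, fun a b => ?_⟩
  have hnorm (w : ℂ) : ‖w‖ ^ 2 = w.re ^ 2 + w.im ^ 2 := by
    rw [← Complex.normSq_eq_norm_sq, Complex.normSq_apply]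
    ring
  rw [hnorm a, hnorm b, ← sub_nonneg]
  simp only [Complex.star_def, Complex.mul_re, Complex.mul_im, Complex.sub_re, Complex.conj_re,
    Complex.conj_im]
  refine nonneg_of_mul_nonneg_right (a := 1 - δ) ?_ (sub_pos.2 hδ1)
  have hnn : 0 ≤ ((1 - δ) * a.re + √k * z.im * b.im) ^ 2 +
      ((1 - δ) * a.im - √k * z.im * b.re) ^ 2 +
      ((1 - δ) * (q - z.re - δ) - k * z.im ^ 2) * (b.re ^ 2 + b.im ^ 2) := by
    have := sub_nonneg.2 h
    positivity
  refine hnn.trans_eq ?_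
  linear_combination (z.im ^ 2 * (b.re ^ 2 + b.im ^ 2)) * hk2

/-- A Lyapunov theorem for left parabolic regions. -/
theorem exists_lyapunov_parabola {n : ℕ} {k q : ℝ} (hk : 0 ≤ k) (A : Matrix (Fin n) (Fin n) ℝ)
    (hA : ∀ z : ℂ, (A.map Complex.ofReal).charpoly.IsRoot z → k * z.im ^ 2 < q - z.re) :
    ∃ P : Matrix (Fin n) (Fin n) ℝ, P.PosDef ∧ ∀ f g : Fin n → ℝ, f ≠ 0 ∨ g ≠ 0 →
      0 < f ⬝ᵥ P *ᵥ f + √k * (g ⬝ᵥ (A * P) *ᵥ f - f ⬝ᵥ (A * P) *ᵥ g) + q * (g ⬝ᵥ P *ᵥ g) -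
        g ⬝ᵥ (A * P) *ᵥ g := by
  obtain ⟨d, hd, h⟩ := (A.map Complex.ofReal).exists_near_diagonal
  obtain ⟨δ, hδ, hgap⟩ : ∃ δ > 0, ∀ i, ∀ a b : ℂ, δ * (‖a‖ ^ 2 + ‖b‖ ^ 2) ≤ ‖a‖ ^ 2 +
      √k * (star b * (d i * a) - star a * (d i * b)).re + q * ‖b‖ ^ 2 -
      (star b * (d i * b)).re := by
    choose δ hδ hgap using fun i => exists_parabola_gap hk (hA _ (hd i))
    obtain ⟨δ', hδ', hle⟩ : ∃ δ' > 0, ∀ i, δ' ≤ δ i := by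
      have : ∀ᶠ x in nhdsWithin (0 : ℝ) (Set.Ioi 0), ∀ i, x ≤ δ i :=
        Filter.eventually_all.2 fun i => nhdsWithin_le_nhds (Iic_mem_nhds (hδ i))
      obtain ⟨x, hx, hx0⟩ := (this.and self_mem_nhdsWithin).exists
      exact ⟨x, hx0, hx⟩
    exact ⟨δ', hδ', fun i a b =>
      (mul_le_mul_of_nonneg_right (hle i) (by positivity)).trans (hgap i a b)⟩
  obtain ⟨ε, hε, hεδ⟩ : ∃ ε > 0, ε * n * (√k + 1) < δ := by
    refine ⟨δ / ((n + 1) * (√k + 1)), by positivity, ?_⟩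
    rw [div_mul_eq_mul_div, div_mul_eq_mul_div, div_lt_iff₀ (by positivity), mul_assoc]
    gcongr
    linarith
  obtain ⟨T, E, hT, hTA, hE⟩ := h ε hε
  let P : Matrix (Fin n) (Fin n) ℝ := (T * Tᴴ).map Complex.re
  have hAP : A * P = (T * (diagonal d + E) * Tᴴ).map Complex.re := by
    rw [← hTA, Matrix.mul_assoc]
    ext i j
    simp [P, mul_apply (M := A), mul_apply (M := A.map Complex.ofReal), Complex.re_sum]
  let L (f : Fin n → ℝ) : Fin n → ℂ := Tᴴ *ᵥ fun i => (f i : ℂ)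
  have hL (U : Matrix (Fin n) (Fin n) ℂ) (f g : Fin n → ℝ) :
      g ⬝ᵥ (T * U * Tᴴ).map Complex.re *ᵥ f = (star (L g) ⬝ᵥ U *ᵥ L f).re := by
    rw [dotProduct_map_re_mulVec]
    simp only [L, star_mulVec, conjTranspose_conjTranspose, ← mulVec_mulVec, dotProduct_mulVec]
  have hLP (f : Fin n → ℝ) : f ⬝ᵥ P *ᵥ f = ∑ i, ‖L f i‖ ^ 2 := by
    have := hL 1 f f
    rw [Matrix.mul_one] at this
    rw [this, one_mulVec]
    simp [dotProduct, Complex.re_sum, ← Complex.normSq_eq_norm_sq, Complex.normSq_apply]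
  have hLpos {f : Fin n → ℝ} (hf : f ≠ 0) : 0 < f ⬝ᵥ P *ᵥ f := by
    rw [hLP]
    have hL0 : L f ≠ 0 := fun h0 => hf <| by
      have := mulVec_injective_of_isUnit ((isUnit_conjTranspose T).2 hT) (h0.trans (mulVec_zero _).symm)
      exact funext fun i => by simpa using congrFun this i
    obtain ⟨i, hi⟩ := Function.ne_iff.1 hL0
    exact Finset.sum_pos' (fun _ _ => by positivity) ⟨i, Finset.mem_univ _, by
      have := norm_pos_iff.2 hi
      positivity⟩
  have hLnn (f : Fin n → ℝ) : 0 ≤ f ⬝ᵥ P *ᵥ f := by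
    rw [hLP]
    positivity
  refine ⟨P, PosDef.of_dotProduct_mulVec_pos ?_ fun f hf => by simpa using hLpos hf,
    fun f g hfg => ?_⟩
  · ext i j
    simpa [P] using congrArg Complex.re
      (congrFun (congrFun (isHermitian_mul_conjTranspose_self T) i) j)
  have hN : 0 < f ⬝ᵥ P *ᵥ f + g ⬝ᵥ P *ᵥ g :=
    hfg.elim (fun h => add_pos_of_pos_of_nonneg (hLpos h) (hLnn g))
      (fun h => add_pos_of_nonneg_of_pos (hLnn f) (hLpos h))
  have hsum := Finset.sum_le_sum fun i (_ : i ∈ Finset.univ) => hgap i (L f i) (L g i)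
  rw [hAP, hL, hL, hL]
  simp only [dotProduct_diagonal_add_mulVec, Complex.add_re]
  have hb (x y : Fin n → ℝ) := abs_le.1 ((Complex.abs_re_le_norm _).trans
    (norm_sum_star_mul_mul_le hE (L x) (L y)))
  simp only [Finset.sum_add_distrib, Finset.sum_sub_distrib, ← Finset.mul_sum, Complex.sub_re,
    ← Complex.re_sum] at hsum
  simp only [← hLP] at hb hsum
  have h1 := hb g f
  have h2 := hb f g
  have h3 := hb g g
  have hs := Real.sqrt_nonneg k
  have h4 := mul_le_mul_of_nonneg_left h1.1 hs
  have h5 := mul_le_mul_of_nonneg_left h2.2 hs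
  have h6 := mul_lt_mul_of_pos_right hεδ hN
  have h7 : 0 ≤ ε * n * (f ⬝ᵥ P *ᵥ f) := mul_nonneg (by positivity) (hLnn f)
  linarith [h3.2]

/-- DH characterization of matrices with all eigenvalues in the left parabolic region
`{x + iy : y² < (2/c_p)(q_p - x)}`. -/
theorem left_parabola_stable_iff_DH {n : ℕ} (qp cp : ℝ) (hcp : 0 < cp)
    (A : Matrix (Fin n) (Fin n) ℝ) :
    (∀ z : ℂ, ((A.map Complex.ofReal).charpoly).IsRoot z →
      z.im ^ 2 < (2 / cp) * (qp - z.re))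
    ↔ ∃ J R Q : Matrix (Fin n) (Fin n) ℝ, Jᵀ = -J ∧ Rᵀ = R ∧ Q.PosDef ∧
        A = (J - R) * Q ∧
        (Matrix.fromBlocks
          Q⁻¹ (-(Real.sqrt (cp / 2)) • J)
          (Real.sqrt (cp / 2) • J) (qp • Q⁻¹ + R)).PosDef := by
  have hk : 0 < cp / 2 := by positivity
  have hΩ (z : ℂ) : z.im ^ 2 < (2 / cp) * (qp - z.re) ↔ cp / 2 * z.im ^ 2 < qp - z.re := by
    rw [← inv_div, ← div_eq_inv_mul, lt_div_iff₀ hk, mul_comm]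
  simp only [hΩ]
  constructor
  · intro h
    obtain ⟨P, hP, hpos⟩ := exists_lyapunov_parabola hk.le A h
    let := hP.isUnit.invertible
    have hPt : Pᵀ = P := (conjTranspose_eq_transpose_of_trivial P).symm.trans hP.1
    have hJ : ((1 / 2 : ℝ) • (A * P - (A * P)ᵀ))ᵀ = -((1 / 2 : ℝ) • (A * P - (A * P)ᵀ)) := by
      simp only [transpose_smul, transpose_sub, transpose_transpose, ← smul_neg, neg_sub]
    have hR : (-(1 / 2 : ℝ) • (A * P + (A * P)ᵀ))ᵀ = -(1 / 2 : ℝ) • (A * P + (A * P)ᵀ) := by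
      simp only [transpose_smul, transpose_add, transpose_transpose, add_comm]
    refine ⟨_, _, P⁻¹, hJ, hR, hP.inv, ?_, ?_⟩
    · have : (1 / 2 : ℝ) • (A * P - (A * P)ᵀ) - -(1 / 2 : ℝ) • (A * P + (A * P)ᵀ) = A * P := by
        module
      rw [this, mul_inv_cancel_right_of_invertible]
    · rw [inv_inv_of_invertible]
      refine PosDef.of_dotProduct_mulVec_pos ?_ fun x hx => ?_
      · exact parabola_block_isHermitian _ _ hPt hJ hR
      · obtain ⟨f, g, rfl⟩ : ∃ f g, x = Sum.elim f g := ⟨_, _, (Sum.elim_comp_inl_inr x).symm⟩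
        rw [star_trivial, parabola_block_quadratic _ _ hJ]
        have hfg : f ≠ 0 ∨ g ≠ 0 := by
          by_contra! h0
          exact hx (by rw [h0.1, h0.2, Sum.elim_zero_zero])
        refine (hpos f g hfg).trans_eq ?_
        simp only [smul_mulVec, add_mulVec, sub_mulVec, dotProduct_smul, dotProduct_add,
          dotProduct_sub, dotProduct_transpose_mulVec, smul_eq_mul]
        ring
  · rintro ⟨J, R, Q, hJ, hR, hQ, rfl, hB⟩ z hz
    let := hQ.isUnit.invertible
    exact root_mem_parabola hk hJ hR hQ.inv (mul_inv_cancel_right_of_invertible _ _) hB hz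
end

section
/- Let a_h, b_h > 0, and let Ω be the left hyperbolic region Ω = {x + iy ∈ ℂ : x < 0 and x²/a_h² − y²/b_h² > 1}. A real n×n matrix A has all of its complex eigenvalues in Ω if and only if A = (J − R)Q for some real n×n matrices J, R, Q with Jᵀ = −J, Rᵀ = R, Q symmetric positive definite, and such that the real symmetric 2n×2n block matrix [[R/a_h, −Q⁻¹ − J/b_h], [−Q⁻¹ + J/b_h, R/a_h]] is positive definite. -/
open Matrix

theorem Module.End.exists_basis_isUpperTriangular {K : Type*} [Field K] [IsAlgClosed K] (n : ℕ) :
    ∀ {V : Type*} [AddCommGroup V] [Module K V] [FiniteDimensional K V] (f : Module.End K V),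
      Module.finrank K V = n →
      ∃ b : Module.Basis (Fin n) K V, (LinearMap.toMatrix b b f).IsUpperTriangular := by
  induction n with
  | zero =>
    intro V _ _ _ f hV
    exact ⟨Module.finBasisOfFinrankEq K V hV, fun i => i.elim0⟩
  | succ n ih =>
    intro V _ _ _ f hV
    have : Nontrivial V := Module.nontrivial_of_finrank_pos (R := K) (by omega)
    obtain ⟨μ, hμ⟩ := Module.End.exists_eigenvalue f
    have hrange : LinearMap.range (f - algebraMap K _ μ) ≠ ⊤ := by
      intro h
      rw [Module.End.hasEigenvalue_iff, Module.End.eigenspace_def] at hμ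
      exact hμ (LinearMap.ker_eq_bot_iff_range_eq_top.mpr h)
    obtain ⟨W, hW, hle⟩ := (eq_top_or_exists_le_coatom _).resolve_left hrange
    have hfW : ∀ x ∈ W, f x ∈ W := fun x hx => by
      have h1 : f x = (f - algebraMap K _ μ) x + μ • x := by
        simp [Module.algebraMap_end_apply]
      rw [h1]
      exact W.add_mem (hle ⟨x, rfl⟩) (W.smul_mem μ hx)
    obtain ⟨y, hy⟩ : ∃ y, y ∉ W := by
      by_contra! h
      exact hW.1 (Submodule.eq_top_iff'.mpr h)
    have hli : ∀ (c : K), ∀ x ∈ W, c • y + x = 0 → c = 0 := by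
      intro c x hx hc
      by_contra hc0
      refine hy ((W.smul_mem_iff hc0).mp ?_)
      rw [eq_neg_of_add_eq_zero_left hc]
      exact W.neg_mem hx
    have hsp : ∀ z : V, ∃ c : K, z + c • y ∈ W := by
      intro z
      have htop : W ⊔ Submodule.span K {y} = ⊤ :=
        hW.2 _ (left_lt_sup.mpr fun h => hy (h (Submodule.mem_span_singleton_self y)))
      obtain ⟨w, hw, v, hv, rfl⟩ := Submodule.mem_sup.mp (htop ▸ Submodule.mem_top : z ∈ _)
      obtain ⟨c, rfl⟩ := Submodule.mem_span_singleton.mp hv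
      exact ⟨-c, by simpa using hw⟩
    have hWn : Module.finrank K W = n := by
      have := Module.finrank_eq_card_basis
        (Module.Basis.mkFinSnoc (Module.finBasis K W) y hli hsp)
      rw [hV, Fintype.card_fin] at this
      omega
    obtain ⟨b, hb⟩ := ih (f.restrict hfW) hWn
    have hbc : ∀ k : Fin n, Module.Basis.mkFinSnoc b y hli hsp k.castSucc = b k := by simp
    refine ⟨Module.Basis.mkFinSnoc b y hli hsp, fun i j hij => ?_⟩
    obtain ⟨j, rfl⟩ := Fin.exists_castSucc_eq.mpr (ne_of_lt (hij.trans_le (Fin.le_last i)))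
    have hsum : f (Module.Basis.mkFinSnoc b y hli hsp j.castSucc) =
        ∑ k, LinearMap.toMatrix b b (f.restrict hfW) k j •
          Module.Basis.mkFinSnoc b y hli hsp k.castSucc := by
      have := congrArg (W.subtype) (b.sum_repr (f.restrict hfW (b j)))
      simp only [map_sum, map_smul, Submodule.subtype_apply, LinearMap.coe_restrict_apply] at this
      simp only [hbc, LinearMap.toMatrix_apply, this]
    rw [LinearMap.toMatrix_apply, hsum, map_sum, Finsupp.finsetSum_apply]
    refine Finset.sum_eq_zero fun k _ => ?_
    rw [map_smul, Module.Basis.repr_self, Finsupp.smul_apply, Finsupp.single_apply]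
    split_ifs with hk
    · subst hk
      rw [hb (by simpa using hij), zero_smul]
    · simp

theorem Matrix.exists_isUpperTriangular_conj {K : Type*} [Field K] [IsAlgClosed K] {n : ℕ}
    (A : Matrix (Fin n) (Fin n) K) :
    ∃ S U : Matrix (Fin n) (Fin n) K, IsUnit S ∧ U.IsUpperTriangular ∧ A * S = S * U ∧
      A.charpoly = U.charpoly := by
  obtain ⟨b, hb⟩ := Module.End.exists_basis_isUpperTriangular n (Matrix.toLin' A) (by simp)
  refine ⟨(Pi.basisFun K (Fin n)).toMatrix b, _, ?_, hb, ?_, ?_⟩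
  · exact (Matrix.isUnit_iff_isUnit_det _).mpr
      ((Pi.basisFun K (Fin n)).isUnit_det b)
  · rw [basis_toMatrix_mul_linearMap_toMatrix]
    have := linearMap_toMatrix_mul_basis_toMatrix b (Pi.basisFun K (Fin n))
      (Pi.basisFun K (Fin n)) (Matrix.toLin' A)
    rw [← this]
    congr 1
    exact (LinearMap.toMatrix'_toLin' A).symm
  · rw [LinearMap.charpoly_toMatrix, ← LinearMap.charpoly_toMatrix _ (Pi.basisFun K (Fin n))]
    congr 1
    exact (LinearMap.toMatrix'_toLin' A).symm

namespace Matrix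

open scoped ComplexOrder

variable {m : Type*}

theorem IsHermitian.posDef_of_re_pos [Fintype m] {M : Matrix m m ℂ} (hM : M.IsHermitian)
    (h : ∀ x, x ≠ 0 → 0 < (star x ⬝ᵥ M *ᵥ x).re) : M.PosDef :=
  .of_dotProduct_mulVec_pos hM fun x hx =>
    Complex.pos_iff.mpr ⟨h x hx, (hM.im_star_dotProduct_mulVec_self x).symm⟩

theorem re_star_dotProduct_mulVec_self_of_skew [Fintype m] {J : Matrix m m ℂ} (hJ : Jᴴ = -J)
    (w : m → ℂ) : (star w ⬝ᵥ J *ᵥ w).re = 0 := by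
  have hIJ : (Complex.I • J).IsHermitian := by simp [IsHermitian, conjTranspose_smul, hJ]
  simpa [smul_mulVec, dotProduct_smul] using hIJ.im_star_dotProduct_mulVec_self w

theorem eventually_posDef [Fintype m] {X : Type*} [TopologicalSpace X] {F : X → Matrix m m ℂ} {x₀ : X}
    (hF : Continuous F) (hH : ∀ t, (F t).IsHermitian) (h₀ : (F x₀).PosDef) :
    ∀ᶠ t in nhds x₀, (F t).PosDef := by
  have hcont : Continuous fun z : X × (m → ℂ) => (star z.2 ⬝ᵥ F z.1 *ᵥ z.2).re := by fun_prop
  have key : ∀ᶠ t in nhds x₀, ∀ y ∈ Metric.sphere (0 : m → ℂ) 1,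
      0 < (star y ⬝ᵥ F t *ᵥ y).re := by
    refine (isCompact_sphere (0 : m → ℂ) 1).eventually_forall_of_forall_eventually fun y hy => ?_
    have hy0 : y ≠ 0 := by
      rintro rfl
      simp at hy
    exact hcont.continuousAt.eventually
      (lt_mem_nhds (Complex.pos_iff.mp (h₀.dotProduct_mulVec_pos hy0)).1)
  filter_upwards [key] with t ht
  refine (hH t).posDef_of_re_pos fun x hx => ?_
  have hx' : 0 < ‖x‖ := norm_pos_iff.mpr hx
  have h1 := ht (((‖x‖⁻¹ : ℝ) : ℂ) • x) (by simp [norm_smul, hx'.ne'])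
  rw [mulVec_smul, star_smul, smul_dotProduct, dotProduct_smul, smul_smul] at h1
  simp only [Complex.star_def, Complex.conj_ofReal, ← Complex.ofReal_mul, smul_eq_mul,
    Complex.re_ofReal_mul] at h1
  exact (pos_iff_pos_of_mul_pos h1).mp (by positivity)

theorem PosDef.map_re [Fintype m] {M : Matrix m m ℂ} (hM : M.PosDef) : (M.map Complex.re).PosDef := by
  refine .of_dotProduct_mulVec_pos ?_ fun x hx => ?_
  · ext i j
    simpa using congrArg Complex.re (hM.isHermitian.apply i j)
  · have hx' : (fun i => (x i : ℂ)) ≠ 0 := fun h => hx (funext fun i => by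
      simpa using congrFun h i)
    have := (Complex.pos_iff.mp (hM.dotProduct_mulVec_pos hx')).1
    simpa [dotProduct, mulVec] using this

open scoped MatrixOrder in
theorem PosDef.map_ofReal [Fintype m] [DecidableEq m] {M : Matrix m m ℝ} (hM : M.PosDef) :
    (M.map Complex.ofReal).PosDef := by
  obtain ⟨B, hB, rfl⟩ := CStarAlgebra.isStrictlyPositive_iff_eq_star_mul_self.mp
    (isStrictlyPositive_iff_posDef.mpr hM)
  have h : (star B * B).map Complex.ofReal =
      (B.map Complex.ofReal)ᴴ * B.map Complex.ofReal := by
    ext i j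
    simp [mul_apply, star_apply]
  rw [h]
  refine .conjTranspose_mul_self _ (mulVec_injective_of_isUnit ?_)
  exact hB.map (Complex.ofRealHom.mapMatrix)

/-- The block matrix `[[R/a, -P - J/b], [-P + J/b, R/a]]`, where `N = J - R` is the decomposition
of `N` into its skew-Hermitian and Hermitian parts. -/
noncomputable def hyperbolaBlock (a b : ℝ) (N P : Matrix m m ℂ) : Matrix (m ⊕ m) (m ⊕ m) ℂ :=
  fromBlocks (a⁻¹ • (-2⁻¹ : ℝ) • (N + Nᴴ)) (-P - b⁻¹ • (2⁻¹ : ℝ) • (N - Nᴴ))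
    (-P + b⁻¹ • (2⁻¹ : ℝ) • (N - Nᴴ)) (a⁻¹ • (-2⁻¹ : ℝ) • (N + Nᴴ))

theorem isHermitian_hyperbolaBlock (a b : ℝ) (N : Matrix m m ℂ) {P : Matrix m m ℂ}
    (hP : P.IsHermitian) : (hyperbolaBlock a b N P).IsHermitian := by
  refine IsHermitian.fromBlocks ?_ ?_ ?_
  · simp [IsHermitian, conjTranspose_smul, add_comm]
  · simp [conjTranspose_smul, hP.eq, ← smul_neg, sub_eq_add_neg]
  · simp [IsHermitian, conjTranspose_smul, add_comm]

theorem hyperbolaBlock_conj [Fintype m] (a b : ℝ) (S N P : Matrix m m ℂ) :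
    hyperbolaBlock a b (S * N * Sᴴ) (S * P * Sᴴ) =
      fromBlocks S 0 0 S * hyperbolaBlock a b N P * (fromBlocks S 0 0 S)ᴴ := by
  simp [hyperbolaBlock, fromBlocks_conjTranspose, fromBlocks_multiply, mul_add, add_mul, mul_sub,
    sub_mul, mul_assoc]

theorem quadratic_pos_of_hyperbola {p y : ℝ} (hp : 0 < p) (h : 1 + y ^ 2 < p ^ 2) {u v : ℂ}
    (huv : u ≠ 0 ∨ v ≠ 0) :
    0 < (star u * (p * u + (-1 - y * Complex.I) * v) +
      star v * ((-1 + y * Complex.I) * u + p * v)).re := by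
  have key : p * (star u * (p * u + (-1 - y * Complex.I) * v) +
      star v * ((-1 + y * Complex.I) * u + p * v)).re =
      Complex.normSq (p * u + (-1 - y * Complex.I) * v) +
        (p ^ 2 - (1 + y ^ 2)) * Complex.normSq v := by
    simp [Complex.normSq_apply]
    ring
  rw [← mul_pos_iff_of_pos_left hp, key]
  by_cases hv : v = 0
  · have hu : u ≠ 0 := huv.resolve_right (not_not.mpr hv)
    have : 0 < Complex.normSq (p * u) := Complex.normSq_pos.mpr (by simp [hp.ne', hu])
    simpa [hv] using this
  · have := Complex.normSq_pos.mpr hv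
    have := Complex.normSq_nonneg (p * u + (-1 - y * Complex.I) * v)
    have := sub_pos.mpr h
    positivity

theorem posDef_hyperbolaBlock_diagonal [Fintype m] [DecidableEq m] {a b : ℝ} (ha : 0 < a)
    {d : m → ℂ}
    (hd : ∀ i, (d i).re < 0 ∧ 1 < (d i).re ^ 2 / a ^ 2 - (d i).im ^ 2 / b ^ 2) :
    (hyperbolaBlock a b (diagonal d) 1).PosDef := by
  refine (isHermitian_hyperbolaBlock a b _ isHermitian_one).posDef_of_re_pos fun x hx => ?_
  have hB : hyperbolaBlock a b (diagonal d) 1 =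
      fromBlocks (diagonal fun i => ((-(d i).re / a : ℝ) : ℂ))
        (diagonal fun i => -1 - ((d i).im / b : ℝ) * Complex.I)
        (diagonal fun i => -1 + ((d i).im / b : ℝ) * Complex.I)
        (diagonal fun i => ((-(d i).re / a : ℝ) : ℂ)) := by
    have h1 : a⁻¹ • (-2⁻¹ : ℝ) • (diagonal d + (diagonal d)ᴴ) =
        diagonal fun i => ((-(d i).re / a : ℝ) : ℂ) := by
      rw [diagonal_conjTranspose, diagonal_add, ← diagonal_smul, ← diagonal_smul]
      congr 1
      ext i
      apply Complex.ext <;> simp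
      ring
    have h2 : b⁻¹ • (2⁻¹ : ℝ) • (diagonal d - (diagonal d)ᴴ) =
        diagonal fun i => ((d i).im / b : ℝ) * Complex.I := by
      rw [diagonal_conjTranspose, diagonal_sub, ← diagonal_smul, ← diagonal_smul]
      congr 1
      ext i
      apply Complex.ext <;> simp
      ring
    rw [hyperbolaBlock, h1, h2, ← diagonal_one, diagonal_neg, diagonal_sub, diagonal_add]
  have hsum : (star x ⬝ᵥ hyperbolaBlock a b (diagonal d) 1 *ᵥ x).re =
      ∑ i, (star (x (.inl i)) * ((-(d i).re / a : ℝ) * x (.inl i) +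
          (-1 - ((d i).im / b : ℝ) * Complex.I) * x (.inr i)) +
        star (x (.inr i)) * ((-1 + ((d i).im / b : ℝ) * Complex.I) * x (.inl i) +
          (-(d i).re / a : ℝ) * x (.inr i))).re := by
    rw [hB, fromBlocks_mulVec, dotProduct, Fintype.sum_sum_type, ← Finset.sum_add_distrib,
      Complex.re_sum]
    simp only [Sum.elim_inl, Sum.elim_inr, Pi.add_apply, mulVec_diagonal, Function.comp_apply,
      Pi.star_apply]
  rw [hsum]
  have hpos : ∀ i, x (.inl i) ≠ 0 ∨ x (.inr i) ≠ 0 → 0 <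
      (star (x (.inl i)) * ((-(d i).re / a : ℝ) * x (.inl i) +
          (-1 - ((d i).im / b : ℝ) * Complex.I) * x (.inr i)) +
        star (x (.inr i)) * ((-1 + ((d i).im / b : ℝ) * Complex.I) * x (.inl i) +
          (-(d i).re / a : ℝ) * x (.inr i))).re := fun i hi => by
    refine quadratic_pos_of_hyperbola (div_pos (neg_pos.mpr (hd i).1) ha) ?_ hi
    rw [div_pow, div_pow, neg_sq]
    linarith [(hd i).2]
  obtain ⟨k, hk⟩ : ∃ i, x (.inl i) ≠ 0 ∨ x (.inr i) ≠ 0 := by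
    obtain ⟨i | i, hi⟩ := Function.ne_iff.mp hx
    exacts [⟨i, .inl hi⟩, ⟨i, .inr hi⟩]
  refine Finset.sum_pos' (fun i _ => ?_) ⟨k, Finset.mem_univ k, hpos k hk⟩
  by_cases hi : x (.inl i) ≠ 0 ∨ x (.inr i) ≠ 0
  · exact (hpos i hi).le
  · push Not at hi
    simp [hi.1, hi.2]

/-- An upper triangular matrix is similar, through a diagonal scaling, to one whose off-diagonal
part is as small as desired. -/
theorem IsUpperTriangular.exists_posDef_hyperbolaBlock {n : ℕ} {a b : ℝ} (ha : 0 < a)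
    {U : Matrix (Fin n) (Fin n) ℂ} (hU : U.IsUpperTriangular)
    (hd : ∀ i, (U i i).re < 0 ∧ 1 < (U i i).re ^ 2 / a ^ 2 - (U i i).im ^ 2 / b ^ 2) :
    ∃ D N : Matrix (Fin n) (Fin n) ℂ, IsUnit D ∧ U * D = D * N ∧
      (hyperbolaBlock a b N 1).PosDef := by
  let F : ℝ → Matrix (Fin n) (Fin n) ℂ := fun t => of fun i j => (t : ℂ) ^ (j - i : ℕ) * U i j
  have hF : Continuous F := by
    refine continuous_matrix fun i j => ?_
    simp only [F, of_apply]
    fun_prop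
  have hF0 : F 0 = diagonal fun i => U i i := by
    ext i j
    rcases lt_trichotomy i j with h | rfl | h
    · have : (j - i : ℕ) ≠ 0 := by have : (i : ℕ) < j := h; omega
      simp [F, this, h.ne]
    · simp [F]
    · simp [F, hU h, h.ne']
  have hcont : Continuous fun t => hyperbolaBlock a b (F t) 1 := by
    unfold hyperbolaBlock
    fun_prop
  have hev := eventually_posDef (x₀ := 0) hcont
    (fun t => isHermitian_hyperbolaBlock a b (F t) isHermitian_one)
    (by rw [hF0]; exact posDef_hyperbolaBlock_diagonal ha hd)
  obtain ⟨t, ht, ht0⟩ := ((hev.filter_mono nhdsWithin_le_nhds).and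
    (self_mem_nhdsWithin (s := Set.Ioi (0 : ℝ)))).exists
  have ht0' : (t : ℂ) ≠ 0 := Complex.ofReal_ne_zero.mpr (ne_of_gt ht0)
  refine ⟨diagonal fun i : Fin n => (t : ℂ) ^ (i : ℕ), F t, ?_, ?_, ht⟩
  · rw [isUnit_iff_isUnit_det, det_diagonal, isUnit_iff_ne_zero]
    exact Finset.prod_ne_zero_iff.mpr fun i _ => pow_ne_zero _ ht0'
  · ext i j
    rw [mul_diagonal, diagonal_mul]
    rcases le_or_gt i j with h | h
    · simp only [F, of_apply, ← mul_assoc, ← pow_add]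
      rw [Nat.add_sub_cancel' h, mul_comm]
    · simp [F, hU h]

theorem exists_posDef_hyperbolaBlock {n : ℕ} {a b : ℝ} (ha : 0 < a)
    (A : Matrix (Fin n) (Fin n) ℂ)
    (hA : ∀ z : ℂ, A.charpoly.IsRoot z → z.re < 0 ∧ 1 < z.re ^ 2 / a ^ 2 - z.im ^ 2 / b ^ 2) :
    ∃ P : Matrix (Fin n) (Fin n) ℂ, P.PosDef ∧ (hyperbolaBlock a b (A * P) P).PosDef := by
  obtain ⟨S, U, hS, hU, hAS, hchar⟩ := A.exists_isUpperTriangular_conj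
  have hd : ∀ i, (U i i).re < 0 ∧ 1 < (U i i).re ^ 2 / a ^ 2 - (U i i).im ^ 2 / b ^ 2 := by
    refine fun i => hA _ ?_
    rw [hchar, charpoly_of_isUpperTriangular U hU, Polynomial.isRoot_prod]
    exact ⟨i, Finset.mem_univ i, by simp⟩
  obtain ⟨D, N, hD, hUD, hN⟩ := hU.exists_posDef_hyperbolaBlock ha hd
  have hT : IsUnit (S * D) := hS.mul hD
  have hAP : A * (S * D * 1 * (S * D)ᴴ) = S * D * N * (S * D)ᴴ := by
    rw [mul_one, ← mul_assoc, ← mul_assoc, hAS, mul_assoc S U D, hUD, ← mul_assoc S D N]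
  refine ⟨S * D * 1 * (S * D)ᴴ, ?_, ?_⟩
  · exact PosDef.one.mul_mul_conjTranspose_same (vecMul_injective_of_isUnit hT)
  · rw [hAP, hyperbolaBlock_conj]
    refine hN.mul_mul_conjTranspose_same (vecMul_injective_of_isUnit ?_)
    rw [isUnit_iff_isUnit_det] at hT ⊢
    rw [det_fromBlocks_zero₂₁]
    exact hT.mul hT

/-- The quadratic form of a positive definite `[[R, -P - J], [-P + J, R]]` at the vectors
`(α w, β w)`. -/
theorem PosDef.hyperbola_of_fromBlocks [Fintype m] {R J P : Matrix m m ℂ} (hJ : Jᴴ = -J)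
    (hP : P.IsHermitian) (h : (fromBlocks R (-P - J) (-P + J) R).PosDef) {w : m → ℂ}
    (hw : w ≠ 0) :
    0 < (star w ⬝ᵥ R *ᵥ w).re ∧
      (star w ⬝ᵥ P *ᵥ w).re ^ 2 + (star w ⬝ᵥ J *ᵥ w).im ^ 2 < (star w ⬝ᵥ R *ᵥ w).re ^ 2 := by
  have hr : (star w ⬝ᵥ R *ᵥ w).im = 0 :=
    (isHermitian_fromBlocks_iff.mp h.isHermitian).1.im_star_dotProduct_mulVec_self w
  have hp : (star w ⬝ᵥ P *ᵥ w).im = 0 := hP.im_star_dotProduct_mulVec_self w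
  have hj := re_star_dotProduct_mulVec_self_of_skew hJ w
  have hform : ∀ α β : ℂ, α ≠ 0 ∨ β ≠ 0 →
      0 < (star α * (α * (star w ⬝ᵥ R *ᵥ w) +
          β * (-(star w ⬝ᵥ P *ᵥ w) - star w ⬝ᵥ J *ᵥ w)) +
        star β * (α * (-(star w ⬝ᵥ P *ᵥ w) + star w ⬝ᵥ J *ᵥ w) +
          β * (star w ⬝ᵥ R *ᵥ w))).re := by
    intro α β hαβ
    have hx : Sum.elim (α • w) (β • w) ≠ 0 := by
      intro h0
      have h1 : α • w = 0 := funext fun i => congrFun h0 (.inl i)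
      have h2 : β • w = 0 := funext fun i => congrFun h0 (.inr i)
      rw [smul_eq_zero_iff_left hw] at h1 h2
      tauto
    have hstar : star (Sum.elim (α • w) (β • w)) = Sum.elim (star α • star w) (star β • star w) := by
      ext (i | i) <;> simp
    have := (Complex.pos_iff.mp (h.dotProduct_mulVec_pos hx)).1
    rw [hstar, fromBlocks_mulVec, sumElim_dotProduct_sumElim] at this
    refine this.trans_eq (congrArg Complex.re ?_)
    simp only [Sum.elim_comp_inl, Sum.elim_comp_inr, mulVec_smul, add_mulVec, sub_mulVec,
      neg_mulVec, smul_dotProduct, dotProduct_add, dotProduct_sub, dotProduct_neg,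
      dotProduct_smul, smul_eq_mul]
    ring
  generalize star w ⬝ᵥ R *ᵥ w = r at *
  generalize star w ⬝ᵥ P *ᵥ w = p at *
  generalize star w ⬝ᵥ J *ᵥ w = j at *
  have hr0 : 0 < r.re := by simpa using hform 1 0 (by simp)
  refine ⟨hr0, ?_⟩
  have hr1 : r ≠ 0 := fun h0 => by simp [h0] at hr0
  have h2 := hform (p + j) r (.inr hr1)
  have h3 : (star (p + j) * ((p + j) * r + r * (-p - j)) +
      star r * ((p + j) * (-p + j) + r * r)).re =
      r.re * (r.re ^ 2 - (p.re ^ 2 + j.im ^ 2)) := by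
    simp [hr, hp, hj]
    ring
  rw [h3, mul_pos_iff_of_pos_left hr0] at h2
  linarith

theorem hyperbola_of_isRoot_charpoly [Fintype m] [DecidableEq m] {ah bh : ℝ} (hah : 0 < ah)
    {J R Q : Matrix m m ℝ} (hJ : Jᵀ = -J) (hR : Rᵀ = R) (hQ : Q.PosDef)
    (hB : (fromBlocks (ah⁻¹ • R) (-Q⁻¹ - bh⁻¹ • J) (-Q⁻¹ + bh⁻¹ • J) (ah⁻¹ • R)).PosDef) {z : ℂ}
    (hz : (((J - R) * Q).map Complex.ofReal).charpoly.IsRoot z) :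
    z.re < 0 ∧ 1 < z.re ^ 2 / ah ^ 2 - z.im ^ 2 / bh ^ 2 := by
  rw [Polynomial.IsRoot.def, eval_charpoly, ← exists_mulVec_eq_zero_iff] at hz
  obtain ⟨v, hv, hvz⟩ := hz
  have hPQ : (Q⁻¹).map Complex.ofReal * Q.map Complex.ofReal = 1 := by
    have := congrArg (Complex.ofRealHom.mapMatrix)
      (nonsing_inv_mul Q ((isUnit_iff_isUnit_det _).mp hQ.isUnit))
    rwa [map_mul, map_one] at this
  have hA : ((J - R) * Q).map Complex.ofReal =
      (J.map Complex.ofReal - R.map Complex.ofReal) * Q.map Complex.ofReal := by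
    have := map_mul Complex.ofRealHom.mapMatrix (J - R) Q
    rwa [map_sub] at this
  set w := Q.map Complex.ofReal *ᵥ v with hw
  have hPw : (Q⁻¹).map Complex.ofReal *ᵥ w = v := by
    rw [hw, mulVec_mulVec, hPQ, one_mulVec]
  have hw0 : w ≠ 0 := by
    intro h
    rw [h, mulVec_zero] at hPw
    exact hv hPw.symm
  have heig : J.map Complex.ofReal *ᵥ w - R.map Complex.ofReal *ᵥ w =
      z • ((Q⁻¹).map Complex.ofReal *ᵥ w) := by
    rw [hPw, ← sub_mulVec, hw, mulVec_mulVec, ← hA]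
    rw [sub_mulVec, sub_eq_zero] at hvz
    rw [← hvz]
    simp [scalar_apply, ← smul_one_eq_diagonal, smul_mulVec]
  have hform := congrArg (star w ⬝ᵥ ·) heig
  simp only [dotProduct_sub, dotProduct_smul, smul_eq_mul] at hform
  have hPc := hQ.inv.map_ofReal
  obtain ⟨hp0, hp⟩ := Complex.pos_iff.mp (hPc.dotProduct_mulVec_pos hw0)
  have hBc : (fromBlocks (ah⁻¹ • R.map Complex.ofReal)
      (-(Q⁻¹).map Complex.ofReal - bh⁻¹ • J.map Complex.ofReal)
      (-(Q⁻¹).map Complex.ofReal + bh⁻¹ • J.map Complex.ofReal)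
      (ah⁻¹ • R.map Complex.ofReal)).PosDef := by
    convert hB.map_ofReal using 1
    ext (i | i) (j | j) <;> simp
  have hJc : (J.map Complex.ofReal)ᴴ = -J.map Complex.ofReal := by
    ext i j
    have := congrFun (congrFun hJ i) j
    simp only [transpose_apply, Matrix.neg_apply] at this
    simp [this]
  have hRc : (R.map Complex.ofReal).IsHermitian := by
    ext i j
    have := congrFun (congrFun hR i) j
    simp only [transpose_apply] at this
    simp [this]
  have hr := hRc.im_star_dotProduct_mulVec_self w
  obtain ⟨h1, h2⟩ := PosDef.hyperbola_of_fromBlocks (by simp [conjTranspose_smul, hJc])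
    hPc.isHermitian hBc hw0
  have hj := re_star_dotProduct_mulVec_self_of_skew hJc w
  simp only [smul_mulVec, dotProduct_smul, Complex.smul_re, Complex.smul_im, smul_eq_mul] at h1 h2
  generalize star w ⬝ᵥ R.map Complex.ofReal *ᵥ w = r at *
  generalize star w ⬝ᵥ (Q⁻¹).map Complex.ofReal *ᵥ w = p at *
  generalize star w ⬝ᵥ J.map Complex.ofReal *ᵥ w = j at *
  have hre := congrArg Complex.re hform
  have him := congrArg Complex.im hform
  simp only [RCLike.im_to_complex] at hr
  simp only [Complex.sub_re, Complex.sub_im, Complex.mul_re, Complex.mul_im, ← hp, hr, hj,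
    mul_zero, sub_zero, zero_sub, zero_add] at hre him
  have hrpos : 0 < r.re := (mul_pos_iff_of_pos_left (inv_pos.mpr hah)).mp h1
  have hrz : r.re = -z.re * p.re := by linarith
  refine ⟨?_, ?_⟩
  · rw [hrz] at hrpos
    linarith [(pos_iff_pos_of_mul_pos hrpos).mpr hp0]
  · rw [hrz, him] at h2
    have h3 : 0 < p.re ^ 2 * (z.re ^ 2 / ah ^ 2 - z.im ^ 2 / bh ^ 2 - 1) := by
      have : p.re ^ 2 * (z.re ^ 2 / ah ^ 2 - z.im ^ 2 / bh ^ 2 - 1) =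
        (ah⁻¹ * (-z.re * p.re)) ^ 2 - (p.re ^ 2 + (bh⁻¹ * (z.im * p.re)) ^ 2) := by
        ring
      linarith
    linarith [(mul_pos_iff_of_pos_left (pow_pos hp0 2)).mp h3]

end Matrix

/-- DH characterization of matrices with all eigenvalues in the left hyperbolic region
`{x + iy : x < 0 ∧ x²/a_h² - y²/b_h² > 1}`. -/
theorem left_hyperbola_stable_iff_DH {n : ℕ} (ah bh : ℝ) (hah : 0 < ah) (hbh : 0 < bh)
    (A : Matrix (Fin n) (Fin n) ℝ) :
    (∀ z : ℂ, ((A.map Complex.ofReal).charpoly).IsRoot z →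
      z.re < 0 ∧ 1 < z.re ^ 2 / ah ^ 2 - z.im ^ 2 / bh ^ 2)
    ↔ ∃ J R Q : Matrix (Fin n) (Fin n) ℝ, Jᵀ = -J ∧ Rᵀ = R ∧ Q.PosDef ∧
        A = (J - R) * Q ∧
        (Matrix.fromBlocks
          (ah⁻¹ • R) (-Q⁻¹ - bh⁻¹ • J)
          (-Q⁻¹ + bh⁻¹ • J) (ah⁻¹ • R)).PosDef := by
  constructor
  · intro hA
    obtain ⟨P, hP, hB⟩ := exists_posDef_hyperbolaBlock hah (A.map Complex.ofReal) hA
    have hPr := hP.map_re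
    have hdet := (isUnit_iff_isUnit_det _).mp hPr.isUnit
    have hAP : (A.map Complex.ofReal * P).map Complex.re = A * P.map Complex.re := by
      ext i j
      simp [mul_apply]
    set N := A * P.map Complex.re with hN
    refine ⟨(2⁻¹ : ℝ) • (N - Nᵀ), (-2⁻¹ : ℝ) • (N + Nᵀ), (P.map Complex.re)⁻¹, ?_, ?_, hPr.inv,
      ?_, ?_⟩
    · simp [← smul_neg]
    · simp [add_comm]
    · have : (2⁻¹ : ℝ) • (N - Nᵀ) - (-2⁻¹ : ℝ) • (N + Nᵀ) = N := by module
      rw [this, hN, mul_nonsing_inv_cancel_right _ _ hdet]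
    · convert hB.map_re using 1
      rw [nonsing_inv_nonsing_inv _ hdet, ← hAP]
      ext (i | i) (j | j) <;> simp [hyperbolaBlock, -conjTranspose_mul]
  · rintro ⟨J, R, Q, hJ, hR, hQ, rfl, hB⟩ z hz
    exact hyperbola_of_isRoot_charpoly hah hJ hR hQ hB hz
end

section
/- Let a_h, b_h > 0, and let Ω be the right hyperbolic region Ω = {x + iy ∈ ℂ : x > 0 and x²/a_h² − y²/b_h² > 1}. A real n×n matrix A has all of its complex eigenvalues in Ω if and only if A = (J − R)Q for some real n×n matrices J, R, Q with Jᵀ = −J, Rᵀ = R, Q symmetric positive definite, and such that the real symmetric 2n×2n block matrix [[−R/a_h, −Q⁻¹ − J/b_h], [−Q⁻¹ + J/b_h, −R/a_h]] is positive definite. -/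
open Matrix

/-- The real part of the sesquilinear form attached to a matrix. -/
noncomputable def reForm {𝕜 ι : Type*} [RCLike 𝕜] [Fintype ι] (N : Matrix ι ι 𝕜)
    (u w : ι → 𝕜) : ℝ :=
  RCLike.re (star u ⬝ᵥ N *ᵥ w)

/-- The quadratic form on pairs of vectors given by the block matrix of the DH characterization,
in terms of `X = Q⁻¹` and `N = J - R`. -/
noncomputable def hyperbolicForm {𝕜 ι : Type*} [RCLike 𝕜] [Fintype ι] (a b : ℝ)
    (N X : Matrix ι ι 𝕜) (u w : ι → 𝕜) : ℝ :=
  a⁻¹ * (reForm N u u + reForm N w w) - 2 * reForm X u w - b⁻¹ * (reForm N u w - reForm N w u)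

theorem reForm_mul_mul_conjTranspose {𝕜 ι : Type*} [RCLike 𝕜] [Fintype ι]
    (T M : Matrix ι ι 𝕜) (u w : ι → 𝕜) :
    reForm (T * M * Tᴴ) u w = reForm M (Tᴴ *ᵥ u) (Tᴴ *ᵥ w) := by
  simp only [reForm, star_mulVec, conjTranspose_conjTranspose, dotProduct_mulVec, vecMul_vecMul]

theorem reForm_smul_smul {𝕜 ι : Type*} [RCLike 𝕜] [Fintype ι]
    (M : Matrix ι ι 𝕜) (c : ℝ) (u w : ι → 𝕜) :
    reForm M (c • u) (c • w) = c ^ 2 * reForm M u w := by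
  simp only [reForm, star_smul, smul_dotProduct, mulVec_smul, dotProduct_smul, RCLike.smul_re,
    star_trivial]
  ring

theorem hyperbolicForm_smul_smul {𝕜 ι : Type*} [RCLike 𝕜] [Fintype ι] (a b : ℝ)
    (N X : Matrix ι ι 𝕜) (c : ℝ) (u w : ι → 𝕜) :
    hyperbolicForm a b N X (c • u) (c • w) = c ^ 2 * hyperbolicForm a b N X u w := by
  simp only [hyperbolicForm, reForm_smul_smul]
  ring

theorem reForm_ofReal {ι : Type*} [Fintype ι] (M : Matrix ι ι ℂ) (u w : ι → ℝ) :
    reForm M (Complex.ofReal ∘ u) (Complex.ofReal ∘ w) = reForm (M.map Complex.re) u w := by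
  simp [reForm, dotProduct, mulVec]

theorem map_ofReal_mul_map_re {ι : Type*} [Fintype ι] (A : Matrix ι ι ℝ) (X : Matrix ι ι ℂ) :
    (A.map Complex.ofReal * X).map Complex.re = A * X.map Complex.re := by
  ext i j
  simp [mul_apply]

theorem reForm_mul {ι : Type*} [Fintype ι] (A X : Matrix ι ι ℝ) (u w : ι → ℝ) :
    reForm (A * X) u w = reForm X (Aᵀ *ᵥ u) w := by
  simp only [reForm, star_trivial, ← mulVec_mulVec]
  rw [dotProduct_mulVec, ← mulVec_transpose]

theorem reForm_comm {ι : Type*} [Fintype ι] {X : Matrix ι ι ℝ} (hX : Xᵀ = X) (u w : ι → ℝ) :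
    reForm X u w = reForm X w u := by
  simp only [reForm, star_trivial]
  rw [dotProduct_mulVec, ← mulVec_transpose, hX, dotProduct_comm]

theorem dotProduct_fromBlocks_mulVec_eq_hyperbolicForm {ι : Type*} [Fintype ι] (a b : ℝ)
    {J R X : Matrix ι ι ℝ} (hJ : Jᵀ = -J) (hR : Rᵀ = R) (hX : Xᵀ = X) (u w : ι → ℝ) :
    star (Sum.elim u w) ⬝ᵥ (fromBlocks (-(a⁻¹ • R)) (-X - b⁻¹ • J) (-X + b⁻¹ • J)
      (-(a⁻¹ • R)) *ᵥ Sum.elim u w) = hyperbolicForm a b (J - R) X u w := by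
  have skew (p q : ι → ℝ) : p ⬝ᵥ J *ᵥ q = -(q ⬝ᵥ J *ᵥ p) := by
    rw [dotProduct_mulVec, ← mulVec_transpose, hJ, dotProduct_comm, neg_mulVec, dotProduct_neg]
  have hXc := reForm_comm hX w u
  have hRc := reForm_comm hR w u
  have hu := skew u u
  have hw := skew w w
  have huw := skew w u
  simp only [reForm, star_trivial, RCLike.re_to_real] at hXc hRc
  simp only [hyperbolicForm, reForm, star_trivial, RCLike.re_to_real, fromBlocks_mulVec,
    sumElim_dotProduct_sumElim, Sum.elim_comp_inl, Sum.elim_comp_inr, sub_mulVec, add_mulVec,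
    neg_mulVec, smul_mulVec, dotProduct_add, dotProduct_sub, dotProduct_neg, dotProduct_smul,
    smul_eq_mul]
  rw [hXc, hRc, huw, show u ⬝ᵥ J *ᵥ u = 0 by linarith, show w ⬝ᵥ J *ᵥ w = 0 by linarith]
  ring

theorem posDef_fromBlocks_iff_hyperbolicForm {ι : Type*} [Fintype ι] (a b : ℝ)
    {J R X : Matrix ι ι ℝ} (hJ : Jᵀ = -J) (hR : Rᵀ = R) (hX : Xᵀ = X) :
    (fromBlocks (-(a⁻¹ • R)) (-X - b⁻¹ • J) (-X + b⁻¹ • J) (-(a⁻¹ • R))).PosDef ↔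
      ∀ u w : ι → ℝ, u ≠ 0 ∨ w ≠ 0 → 0 < hyperbolicForm a b (J - R) X u w := by
  rw [posDef_iff_dotProduct_mulVec]
  constructor
  · rintro ⟨-, h⟩ u w huw
    rw [← dotProduct_fromBlocks_mulVec_eq_hyperbolicForm a b hJ hR hX]
    refine h fun h0 ↦ ?_
    have h1 : u = 0 := funext fun i ↦ congrFun h0 (Sum.inl i)
    have h2 : w = 0 := funext fun i ↦ congrFun h0 (Sum.inr i)
    tauto
  · refine fun h ↦ ⟨?_, fun x hx ↦ ?_⟩
    · rw [IsHermitian, conjTranspose_eq_transpose_of_trivial, fromBlocks_transpose]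
      simp [hJ, hR, hX, sub_eq_add_neg]
    · rw [← Sum.elim_comp_inl_inr x,
        dotProduct_fromBlocks_mulVec_eq_hyperbolicForm a b hJ hR hX]
      apply h
      by_contra! h0
      refine hx ?_
      rw [← Sum.elim_comp_inl_inr x, h0.1, h0.2]
      ext (i | i) <;> rfl

/-- Every endomorphism of a finite-dimensional space over an algebraically closed field is
lower triangular in some basis. -/
theorem Module.End.exists_basis_lowerTriangular {K : Type*} [Field K] [IsAlgClosed K] (n : ℕ)
    {V : Type*} [AddCommGroup V] [Module K V] [FiniteDimensional K V]
    (hn : Module.finrank K V = n) (f : Module.End K V) :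
    ∃ (b : Module.Basis (Fin n) K V) (U : Matrix (Fin n) (Fin n) K),
      U.IsLowerTriangular ∧ ∀ j, f (b j) = ∑ i, U i j • b i := by
  induction n generalizing V with
  | zero => exact ⟨Module.finBasisOfFinrankEq K V hn, 0, fun i ↦ i.elim0, fun j ↦ j.elim0⟩
  | succ n ih =>
    have : Nontrivial V := Module.nontrivial_of_finrank_pos (R := K) (by omega)
    obtain ⟨μ, hμ⟩ := f.exists_eigenvalue
    have hrange : LinearMap.range (f - algebraMap K (Module.End K V) μ) < ⊤ := by
      refine lt_top_iff_ne_top.mpr fun h ↦ hμ ?_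
      rw [Module.End.genEigenspace_one, ← LinearMap.ker_eq_bot_iff_range_eq_top.mpr h]
      rfl
    obtain ⟨φ, hφ, hle⟩ := Submodule.exists_le_ker_of_lt_top _ hrange
    have hφf (v : V) : φ (f v) = μ * φ v := by
      have h : φ ((f - algebraMap K (Module.End K V) μ) v) = 0 := hle ⟨v, rfl⟩
      simpa [sub_eq_zero] using h
    have hinv : ∀ v ∈ LinearMap.ker φ, f v ∈ LinearMap.ker φ := fun v hv ↦ by
      rw [LinearMap.mem_ker] at hv ⊢
      rw [hφf, hv, mul_zero]
    have hrank := Module.Dual.finrank_ker_add_one_of_ne_zero hφ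
    obtain ⟨b, U, hU, hb⟩ := ih (by omega) (f.restrict hinv)
    obtain ⟨y, hy⟩ : ∃ y, φ y = 1 := (LinearMap.surjective hφ) 1
    let b' := Module.Basis.mkFinCons y b
      (fun c x hx h ↦ by simpa [hy, LinearMap.mem_ker.mp hx] using congrArg φ h)
      (fun z ↦ ⟨-φ z, by simp [hy]⟩)
    have hb' : ⇑b' = Fin.cons y ((↑) ∘ b) := Module.Basis.coe_mkFinCons ..
    refine ⟨b', Matrix.of fun i j ↦ Fin.cases (b'.repr (f y) i)
      (fun j ↦ Fin.cases 0 (fun i ↦ U i j) i) j, fun i j hij ↦ ?_, fun j ↦ ?_⟩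
    · induction j using Fin.cases with
      | zero => exact absurd (OrderDual.toDual_lt_toDual.mp hij) (Fin.not_lt_zero i)
      | succ j =>
        induction i using Fin.cases with
        | zero => rfl
        | succ i => exact hU (OrderDual.toDual_lt_toDual.mpr
          (Fin.succ_lt_succ_iff.mp (OrderDual.toDual_lt_toDual.mp hij)))
    · induction j using Fin.cases with
      | zero =>
        rw [hb', Fin.cons_zero, ← hb']
        exact (b'.sum_repr (f y)).symm
      | succ j => simpa [hb', Fin.sum_univ_succ] using congrArg Subtype.val (hb j)

theorem Matrix.exists_mul_eq_mul_lowerTriangular {K : Type*} [Field K] [IsAlgClosed K] {n : ℕ}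
    (A : Matrix (Fin n) (Fin n) K) :
    ∃ T U : Matrix (Fin n) (Fin n) K, IsUnit T ∧ U.IsLowerTriangular ∧ A * T = T * U := by
  obtain ⟨b, U, hU, hb⟩ := Module.End.exists_basis_lowerTriangular n
    (Module.finrank_fin_fun K) A.mulVecLin
  refine ⟨(Pi.basisFun K (Fin n)).toMatrix b, U, ?_, hU, ?_⟩
  · have := (Pi.basisFun K (Fin n)).invertibleToMatrix b
    exact isUnit_of_invertible _
  · ext i j
    have h := congrFun (hb j) i
    simp only [mulVecLin_apply, Finset.sum_apply, Pi.smul_apply, smul_eq_mul] at h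
    simpa [mul_apply, mulVec, dotProduct, Module.Basis.toMatrix_apply, mul_comm] using h

theorem Matrix.isRoot_charpoly_of_mul_eq_mul_lowerTriangular {K : Type*} [Field K] {n : ℕ}
    {A T U : Matrix (Fin n) (Fin n) K} (hT : IsUnit T) (hU : U.IsLowerTriangular)
    (h : A * T = T * U) (i : Fin n) : A.charpoly.IsRoot (U i i) := by
  obtain ⟨T, rfl⟩ := hT
  have hA : A = T.val * U * T.val⁻¹ := by
    rw [← h, mul_assoc, ← coe_units_inv, Units.mul_inv, mul_one]
  have hUt : Uᵀ.IsUpperTriangular := hU.transpose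
  rw [hA, charpoly_units_conj, ← charpoly_transpose, charpoly_of_isUpperTriangular _ hUt,
    Polynomial.IsRoot, Polynomial.eval_prod]
  exact Finset.prod_eq_zero (Finset.mem_univ i) (by simp)

theorem hyperbolic_scalar_form_pos {a b : ℝ} (ha : 0 < a) {l : ℂ} (hre : 0 < l.re)
    (hl : 1 < l.re ^ 2 / a ^ 2 - l.im ^ 2 / b ^ 2) {u w : ℂ} (huw : u ≠ 0 ∨ w ≠ 0) :
    0 < a⁻¹ * ((star u * (l * u)).re + (star w * (l * w)).re) - 2 * (star u * w).re
      - b⁻¹ * ((star u * (l * w)).re - (star w * (l * u)).re) := by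
  obtain ⟨x, y⟩ := l
  obtain ⟨p, q⟩ := u
  obtain ⟨r, t⟩ := w
  simp only [Complex.star_def, Complex.mul_re, Complex.mul_im, Complex.conj_re, Complex.conj_im,
    ne_eq, Complex.ext_iff, Complex.zero_re, Complex.zero_im] at *
  have hs : 0 < a⁻¹ * x := by positivity
  have hm : 0 < (a⁻¹ * x) ^ 2 - 1 - (b⁻¹ * y) ^ 2 := by
    have : (a⁻¹ * x) ^ 2 - (b⁻¹ * y) ^ 2 = x ^ 2 / a ^ 2 - y ^ 2 / b ^ 2 := by
      simp only [mul_pow, inv_pow]; ring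
    linarith
  have key : 0 < (a⁻¹ * x) * (a⁻¹ * x * (p ^ 2 + q ^ 2 + r ^ 2 + t ^ 2)
      + 2 * (-(p * r + q * t) + b⁻¹ * y * (p * t - q * r))) := by
    generalize a⁻¹ * x = s at *
    generalize b⁻¹ * y = m at *
    have e : s * (s * (p ^ 2 + q ^ 2 + r ^ 2 + t ^ 2)
        + 2 * (-(p * r + q * t) + m * (p * t - q * r))) =
        (s * p - r + m * t) ^ 2 + (s * q - t - m * r) ^ 2
          + (s ^ 2 - 1 - m ^ 2) * (r ^ 2 + t ^ 2) := by ring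
    rw [e]
    by_cases hw : r = 0 ∧ t = 0
    · obtain ⟨rfl, rfl⟩ := hw
      have hp : 0 < p ^ 2 + q ^ 2 := by
        by_cases hp : p = 0
        · have : q ≠ 0 := by tauto
          positivity
        · positivity
      have := mul_pos (pow_pos hs 2) hp
      nlinarith
    · have hr : 0 < r ^ 2 + t ^ 2 := by
        by_cases hr : r = 0
        · have : t ≠ 0 := by tauto
          positivity
        · positivity
      positivity
  have := pos_of_mul_pos_right key hs.le
  linarith

theorem hyperbolicForm_diagonal_pos {ι : Type*} [Fintype ι] [DecidableEq ι] {a b : ℝ}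
    (ha : 0 < a) {l : ι → ℂ}
    (hl : ∀ i, 0 < (l i).re ∧ 1 < (l i).re ^ 2 / a ^ 2 - (l i).im ^ 2 / b ^ 2)
    {u w : ι → ℂ} (huw : u ≠ 0 ∨ w ≠ 0) : 0 < hyperbolicForm a b (diagonal l) 1 u w := by
  have e : hyperbolicForm a b (diagonal l) 1 u w = ∑ i,
      (a⁻¹ * ((star (u i) * (l i * u i)).re + (star (w i) * (l i * w i)).re)
        - 2 * (star (u i) * w i).re
        - b⁻¹ * ((star (u i) * (l i * w i)).re - (star (w i) * (l i * u i)).re)) := by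
    simp only [hyperbolicForm, reForm, one_mulVec, dotProduct, mulVec_diagonal, Pi.star_apply,
      RCLike.re_to_complex, Complex.re_sum, Finset.sum_sub_distrib, ← Finset.mul_sum,
      Finset.sum_add_distrib]
  rw [e]
  obtain ⟨i, hi⟩ : ∃ i, u i ≠ 0 ∨ w i ≠ 0 := by
    by_contra! h
    exact huw.elim (· (funext fun i ↦ (h i).1)) (· (funext fun i ↦ (h i).2))
  refine Finset.sum_pos' (fun j _ ↦ ?_) ⟨i, Finset.mem_univ i,
    hyperbolic_scalar_form_pos ha (hl i).1 (hl i).2 hi⟩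
  by_cases h : u j ≠ 0 ∨ w j ≠ 0
  · exact (hyperbolic_scalar_form_pos ha (hl j).1 (hl j).2 h).le
  · push Not at h
    simp [h.1, h.2]

/-- A lower triangular matrix, conjugated by powers of `δ` so that it tends to its diagonal
as `δ` tends to zero. -/
noncomputable def scaledLower {n : ℕ} (U : Matrix (Fin n) (Fin n) ℂ) (δ : ℝ) :
    Matrix (Fin n) (Fin n) ℂ :=
  Matrix.of fun i j ↦ (δ : ℂ) ^ (i.val - j.val) * U i j

theorem scaledLower_zero {n : ℕ} {U : Matrix (Fin n) (Fin n) ℂ} (hU : U.IsLowerTriangular) :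
    scaledLower U 0 = diagonal fun i ↦ U i i := by
  ext i j
  rcases lt_trichotomy i j with h | rfl | h
  · simp [scaledLower, hU h, h.ne]
  · simp [scaledLower]
  · have : i.val - j.val ≠ 0 := by have := Fin.lt_def.mp h; omega
    simp [scaledLower, h.ne', this]

theorem mul_diagonal_eq_diagonal_mul_scaledLower {n : ℕ} {U : Matrix (Fin n) (Fin n) ℂ}
    (hU : U.IsLowerTriangular) (δ : ℝ) :
    U * diagonal (fun i : Fin n ↦ (δ : ℂ) ^ (n - i.val)) =
      diagonal (fun i : Fin n ↦ (δ : ℂ) ^ (n - i.val)) * scaledLower U δ := by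
  ext i j
  rw [mul_diagonal, diagonal_mul, scaledLower, of_apply]
  rcases lt_or_ge i j with h | h
  · simp [hU h]
  · rw [← mul_assoc, ← pow_add, mul_comm]
    congr 2
    have := Fin.le_def.mp h
    omega

theorem exists_scaledLower_hyperbolicForm_pos {n : ℕ} {a b : ℝ} (ha : 0 < a)
    {U : Matrix (Fin n) (Fin n) ℂ} (hU : U.IsLowerTriangular)
    (hl : ∀ i, 0 < (U i i).re ∧ 1 < (U i i).re ^ 2 / a ^ 2 - (U i i).im ^ 2 / b ^ 2) :
    ∃ δ : ℝ, 0 < δ ∧ ∀ u w : Fin n → ℂ, u ≠ 0 ∨ w ≠ 0 →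
      0 < hyperbolicForm a b (scaledLower U δ) 1 u w := by
  have hcont : Continuous fun z : ℝ × ((Fin n → ℂ) × (Fin n → ℂ)) ↦
      hyperbolicForm a b (scaledLower U z.1) 1 z.2.1 z.2.2 := by
    simp only [hyperbolicForm, reForm, scaledLower, dotProduct, mulVec, of_apply, Pi.star_apply,
      RCLike.re_to_complex]
    fun_prop
  have hev := (isCompact_sphere (0 : (Fin n → ℂ) × (Fin n → ℂ)) 1)
    |>.eventually_forall_of_forall_eventually (x₀ := (0 : ℝ))
    (P := fun δ v ↦ 0 < hyperbolicForm a b (scaledLower U δ) 1 v.1 v.2) fun v hv ↦ by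
      refine hcont.continuousAt.eventually (lt_mem_nhds ?_)
      simp only [scaledLower_zero hU]
      refine hyperbolicForm_diagonal_pos ha hl ?_
      by_contra! h
      have : v = 0 := Prod.ext h.1 h.2
      simp [this] at hv
  obtain ⟨δ, hδ, hpos⟩ := ((hev.filter_mono nhdsWithin_le_nhds).and
    (self_mem_nhdsWithin (s := Set.Ioi (0 : ℝ)))).exists
  refine ⟨δ, hpos, fun u w huw ↦ ?_⟩
  have hv : (u, w) ≠ 0 := by
    rw [Ne, Prod.mk_eq_zero]
    tauto
  have h := hδ (‖(u, w)‖⁻¹ • (u, w)) (by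
    rw [mem_sphere_zero_iff_norm, norm_smul, norm_inv, norm_norm,
      inv_mul_cancel₀ (norm_ne_zero_iff.mpr hv)])
  simp only [Prod.smul_mk, hyperbolicForm_smul_smul] at h
  exact pos_of_mul_pos_right h (by positivity)

/-- A matrix with spectrum in the right hyperbolic region is similar to one whose hyperbolic
form is positive. -/
theorem exists_similar_hyperbolicForm_pos {n : ℕ} {a b : ℝ} (ha : 0 < a)
    {A : Matrix (Fin n) (Fin n) ℂ}
    (hA : ∀ z : ℂ, A.charpoly.IsRoot z → 0 < z.re ∧ 1 < z.re ^ 2 / a ^ 2 - z.im ^ 2 / b ^ 2) :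
    ∃ T B : Matrix (Fin n) (Fin n) ℂ, IsUnit T ∧ A * T = T * B ∧
      ∀ u w : Fin n → ℂ, u ≠ 0 ∨ w ≠ 0 → 0 < hyperbolicForm a b B 1 u w := by
  obtain ⟨T, U, hT, hU, hAT⟩ := A.exists_mul_eq_mul_lowerTriangular
  obtain ⟨δ, hδ, hpos⟩ := exists_scaledLower_hyperbolicForm_pos (b := b) ha hU
    fun i ↦ hA _ (isRoot_charpoly_of_mul_eq_mul_lowerTriangular hT hU hAT i)
  refine ⟨T * diagonal fun i : Fin n ↦ (δ : ℂ) ^ (n - i.val), scaledLower U δ, hT.mul ?_, ?_, hpos⟩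
  · rw [isUnit_diagonal, Pi.isUnit_iff]
    exact fun i ↦ (pow_ne_zero _ (Complex.ofReal_ne_zero.mpr hδ.ne')).isUnit
  · rw [← mul_assoc, hAT, mul_assoc, mul_diagonal_eq_diagonal_mul_scaledLower hU, mul_assoc]

open scoped ComplexOrder in
theorem exists_posDef_hyperbolicForm_pos {n : ℕ} {a b : ℝ} (ha : 0 < a)
    {A : Matrix (Fin n) (Fin n) ℝ}
    (hA : ∀ z : ℂ, (A.map Complex.ofReal).charpoly.IsRoot z →
      0 < z.re ∧ 1 < z.re ^ 2 / a ^ 2 - z.im ^ 2 / b ^ 2) :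
    ∃ X : Matrix (Fin n) (Fin n) ℝ, X.PosDef ∧
      ∀ u w : Fin n → ℝ, u ≠ 0 ∨ w ≠ 0 → 0 < hyperbolicForm a b (A * X) X u w := by
  obtain ⟨T, B, hT, hAT, hpos⟩ := exists_similar_hyperbolicForm_pos ha hA
  have hinj : Function.Injective (Tᴴ).mulVec :=
    mulVec_injective_iff_isUnit.mpr ((isUnit_conjTranspose T).mpr hT)
  have hne {u : Fin n → ℝ} (hu : u ≠ 0) : Tᴴ *ᵥ (Complex.ofReal ∘ u) ≠ 0 := fun h ↦ by
    have h0 := hinj (h.trans (mulVec_zero _).symm)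
    exact hu (funext fun i ↦ Complex.ofReal_eq_zero.mp (congrFun h0 i))
  have hX (u w : Fin n → ℝ) : reForm ((T * Tᴴ).map Complex.re) u w =
      reForm 1 (Tᴴ *ᵥ (Complex.ofReal ∘ u)) (Tᴴ *ᵥ (Complex.ofReal ∘ w)) := by
    rw [← reForm_mul_mul_conjTranspose, mul_one, reForm_ofReal]
  have hAX (u w : Fin n → ℝ) : reForm (A * (T * Tᴴ).map Complex.re) u w =
      reForm B (Tᴴ *ᵥ (Complex.ofReal ∘ u)) (Tᴴ *ᵥ (Complex.ofReal ∘ w)) := by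
    rw [← reForm_mul_mul_conjTranspose, ← hAT, mul_assoc, reForm_ofReal, map_ofReal_mul_map_re]
  refine ⟨(T * Tᴴ).map Complex.re, .of_dotProduct_mulVec_pos ?_ fun u hu ↦ ?_, fun u w huw ↦ ?_⟩
  · ext i j
    have h := congrArg Complex.re ((isHermitian_mul_conjTranspose_self T).apply i j)
    simpa using h
  · have h := hX u u
    simp only [reForm, RCLike.re_to_real] at h
    rw [h, one_mulVec]
    have := dotProduct_star_self_pos_iff.mpr (hne hu)
    exact (Complex.lt_def.mp this).1
  · simp only [hyperbolicForm, hX, hAX]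
    exact hpos _ _ (huw.imp hne hne)

theorem exists_real_pair_of_isRoot_charpoly {n : ℕ} {A : Matrix (Fin n) (Fin n) ℝ} {z : ℂ}
    (hz : (A.map Complex.ofReal).charpoly.IsRoot z) :
    ∃ p q : Fin n → ℝ, (p ≠ 0 ∨ q ≠ 0) ∧ A *ᵥ p = z.re • p - z.im • q ∧
      A *ᵥ q = z.im • p + z.re • q := by
  rw [← charpoly_mulVecLin, ← Module.End.hasEigenvalue_iff_isRoot_charpoly] at hz
  obtain ⟨v, hv⟩ := hz.exists_hasEigenvector
  have hev : A.map Complex.ofReal *ᵥ v = z • v := hv.apply_eq_smul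
  refine ⟨fun i ↦ (v i).re, fun i ↦ (v i).im, ?_, ?_, ?_⟩
  · by_contra! h
    exact hv.2 (funext fun i ↦ Complex.ext (congrFun h.1 i) (congrFun h.2 i))
  · ext i
    simpa [mulVec, dotProduct] using congrArg Complex.re (congrFun hev i)
  · ext i
    simpa [mulVec, dotProduct, add_comm] using congrArg Complex.im (congrFun hev i)

theorem mem_hyperbolic_region_of_hyperbolicForm_pos {n : ℕ} {a b : ℝ} (ha : 0 < a)
    {A X : Matrix (Fin n) (Fin n) ℝ} (hX : X.PosDef)
    (hpos : ∀ u w : Fin n → ℝ, u ≠ 0 ∨ w ≠ 0 → 0 < hyperbolicForm a b (A * X) X u w)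
    {z : ℂ} (hz : (A.map Complex.ofReal).charpoly.IsRoot z) :
    0 < z.re ∧ 1 < z.re ^ 2 / a ^ 2 - z.im ^ 2 / b ^ 2 := by
  rw [← charpoly_transpose, ← transpose_map] at hz
  obtain ⟨p, q, hpq, hp, hq⟩ := exists_real_pair_of_isRoot_charpoly hz
  generalize z.re = x at *
  generalize z.im = y at *
  have hXt : Xᵀ = X := by simpa using hX.isHermitian.eq
  have hcomm := reForm_comm hXt q p
  have nonneg (v : Fin n → ℝ) : 0 ≤ reForm X v v := hX.posSemidef.dotProduct_mulVec_nonneg v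
  have pos {v : Fin n → ℝ} (hv : v ≠ 0) : 0 < reForm X v v := hX.dotProduct_mulVec_pos hv
  have hPH : 0 < reForm X p p + reForm X q q := by
    rcases hpq with h | h
    · linarith [pos h, nonneg q]
    · linarith [pos h, nonneg p]
  have form_nonneg (u w : Fin n → ℝ) : 0 ≤ hyperbolicForm a b (A * X) X u w := by
    by_cases h : u ≠ 0 ∨ w ≠ 0
    · exact (hpos u w h).le
    · push Not at h
      simp [h.1, h.2, hyperbolicForm, reForm]
  have sum_pos (u w u' w' : Fin n → ℝ) (h : (u ≠ 0 ∨ w ≠ 0) ∨ (u' ≠ 0 ∨ w' ≠ 0)) :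
      0 < hyperbolicForm a b (A * X) X u w + hyperbolicForm a b (A * X) X u' w' := by
    rcases h with h | h
    · linarith [hpos u w h, form_nonneg u' w']
    · linarith [hpos u' w' h, form_nonneg u w]
  have h1 := sum_pos p 0 q 0 (by tauto)
  have hs : 0 < a⁻¹ * x := by
    refine pos_of_mul_pos_left (b := reForm X p p + reForm X q q) ?_ hPH.le
    refine h1.trans_eq ?_
    simp only [hyperbolicForm, reForm_mul, hp, hq]
    simp only [reForm, star_trivial, RCLike.re_to_real, mulVec_zero, dotProduct_zero,
      sub_dotProduct, add_dotProduct, smul_dotProduct, smul_eq_mul, zero_dotProduct] at hcomm ⊢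
    rw [hcomm]
    ring
  have hx : 0 < x := pos_of_mul_pos_right hs (by positivity)
  refine ⟨hx, ?_⟩
  have h2 := sum_pos ((a⁻¹ * x) • p) (p - (b⁻¹ * y) • q) ((a⁻¹ * x) • q) (q + (b⁻¹ * y) • p) (by
    rcases hpq with h | h
    · exact .inl (.inl (smul_ne_zero hs.ne' h))
    · exact .inr (.inl (smul_ne_zero hs.ne' h)))
  have hm : 0 < (a⁻¹ * x) ^ 2 - 1 - (b⁻¹ * y) ^ 2 := by
    refine pos_of_mul_pos_right (a := a⁻¹ * x * (reForm X p p + reForm X q q)) ?_ (by positivity)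
    refine h2.trans_eq ?_
    simp only [hyperbolicForm, reForm_mul, mulVec_sub, mulVec_add, mulVec_smul, hp, hq]
    simp only [reForm, star_trivial, RCLike.re_to_real, mulVec_sub, mulVec_add, mulVec_smul,
      dotProduct_add, dotProduct_sub, dotProduct_smul,
      sub_dotProduct, add_dotProduct, smul_dotProduct, smul_eq_mul] at hcomm ⊢
    rw [hcomm]
    ring
  have : (a⁻¹ * x) ^ 2 - (b⁻¹ * y) ^ 2 = x ^ 2 / a ^ 2 - y ^ 2 / b ^ 2 := by
    simp only [mul_pow, inv_pow]; ring
  linarith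

/-- DH characterization of matrices with all eigenvalues in the right hyperbolic region
`{x + iy : x > 0 ∧ x²/a_h² - y²/b_h² > 1}`. -/
theorem right_hyperbola_stable_iff_DH {n : ℕ} (ah bh : ℝ) (hah : 0 < ah) (hbh : 0 < bh)
    (A : Matrix (Fin n) (Fin n) ℝ) :
    (∀ z : ℂ, ((A.map Complex.ofReal).charpoly).IsRoot z →
      0 < z.re ∧ 1 < z.re ^ 2 / ah ^ 2 - z.im ^ 2 / bh ^ 2)
    ↔ ∃ J R Q : Matrix (Fin n) (Fin n) ℝ, Jᵀ = -J ∧ Rᵀ = R ∧ Q.PosDef ∧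
        A = (J - R) * Q ∧
        (Matrix.fromBlocks
          (-(ah⁻¹ • R)) (-Q⁻¹ - bh⁻¹ • J)
          (-Q⁻¹ + bh⁻¹ • J) (-(ah⁻¹ • R))).PosDef := by
  constructor
  · intro hA
    obtain ⟨X, hX, hpos⟩ := exists_posDef_hyperbolicForm_pos hah hA
    have hXt : Xᵀ = X := by simpa using hX.isHermitian.eq
    have hdet : IsUnit X.det := hX.det_pos.ne'.isUnit
    have hJ : ((1 / 2 : ℝ) • (A * X - X * Aᵀ))ᵀ = -((1 / 2 : ℝ) • (A * X - X * Aᵀ)) := by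
      simp [hXt, ← smul_neg]
    have hR : (-(1 / 2 : ℝ) • (A * X + X * Aᵀ))ᵀ = -(1 / 2 : ℝ) • (A * X + X * Aᵀ) := by
      simp [hXt, add_comm]
    have hN : (1 / 2 : ℝ) • (A * X - X * Aᵀ) - -(1 / 2 : ℝ) • (A * X + X * Aᵀ) = A * X := by
      module
    refine ⟨_, _, X⁻¹, hJ, hR, hX.inv, ?_, ?_⟩
    · rw [hN, mul_nonsing_inv_cancel_right _ _ hdet]
    · rw [nonsing_inv_nonsing_inv _ hdet, posDef_fromBlocks_iff_hyperbolicForm ah bh hJ hR hXt, hN]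
      exact hpos
  · rintro ⟨J, R, Q, hJ, hR, hQ, rfl, hM⟩ z hz
    have hXt : (Q⁻¹)ᵀ = Q⁻¹ := by simpa using hQ.inv.isHermitian.eq
    refine mem_hyperbolic_region_of_hyperbolicForm_pos hah hQ.inv ?_ hz
    rw [mul_nonsing_inv_cancel_right _ _ hQ.det_pos.ne'.isUnit]
    exact (posDef_fromBlocks_iff_hyperbolicForm ah bh hJ hR hXt).mp hM
end

section
/- Let w > 0, and let Ω be the horizontal strip Ω = {z ∈ ℂ : |Im(z)| < w}. A real n×n matrix A has all of its complex eigenvalues in Ω if and only if A = (J − R)Q for some real n×n matrices J, R, Q with Jᵀ = −J, Rᵀ = R, Q symmetric positive definite, and such that the real symmetric 2n×2n block matrix [[wQ⁻¹, −J], [J, wQ⁻¹]] is positive definite. -/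
open Matrix

/-- For an endomorphism whose eigenvalues have imaginary part of modulus less than `w`, there is a
linear embedding into an inner product space for which the numerical range lies in a strip of
half-width less than `w`. -/
theorem exists_embedding_abs_im_inner_le {V : Type*} [AddCommGroup V] [Module ℂ V]
    [FiniteDimensional ℂ V] (f : Module.End ℂ V) {w : ℝ} (hw : 0 < w)
    (hf : ∀ z, f.HasEigenvalue z → |z.im| < w) :
    ∃ (E : Type) (_ : NormedAddCommGroup E) (_ : InnerProductSpace ℂ E) (T : V →ₗ[ℂ] E),
      Function.Injective T ∧
        ∃ w' < w, ∀ x, |(inner ℂ (T x) (T (f x))).im| ≤ w' * ‖T x‖ ^ 2 := by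
  induction hn : Module.finrank ℂ V generalizing V with
  | zero =>
    have : Subsingleton V := Module.finrank_zero_iff.mp hn
    refine ⟨ℂ, inferInstance, inferInstance, 0, Function.injective_of_subsingleton _, 0, hw, ?_⟩
    simp
  | succ n ih =>
    have : Nontrivial V := Module.nontrivial_of_finrank_pos (R := ℂ) (by omega)
    obtain ⟨z, hz⟩ := Module.End.exists_eigenvalue f
    have hrange : LinearMap.range (f - z • (1 : Module.End ℂ V)) < ⊤ := by
      rw [lt_top_iff_ne_top, Ne, LinearMap.range_eq_top, ← LinearMap.injective_iff_surjective,
        ← LinearMap.ker_eq_bot, ← Module.End.eigenspace_def]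
      exact hz
    obtain ⟨φ, hφ, hle⟩ := Submodule.exists_le_ker_of_lt_top _ hrange
    have hφf (x : V) : φ (f x) = z * φ x := by
      have := hle (LinearMap.mem_range_self _ x)
      simpa [sub_eq_zero] using this
    obtain ⟨e, he⟩ : ∃ e, φ e = 1 := LinearMap.surjective hφ 1
    have hmaps : ∀ x ∈ LinearMap.ker φ, f x ∈ LinearMap.ker φ := by
      intro x hx
      simp_all
    have hrank : Module.finrank ℂ (LinearMap.ker φ) = n := by
      have h1 := LinearMap.finrank_range_add_finrank_ker φ
      rw [LinearMap.range_eq_top.mpr (LinearMap.surjective hφ), finrank_top,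
        Module.finrank_self] at h1
      omega
    have heig (μ : ℂ) (hμ : Module.End.HasEigenvalue (f.restrict hmaps) μ) : |μ.im| < w := by
      obtain ⟨x, hx⟩ := hμ.exists_hasEigenvector
      refine hf μ (Module.End.hasEigenvalue_of_hasEigenvector (x := (x : V)) ?_)
      rw [Module.End.hasEigenvector_iff, Module.End.mem_eigenspace_iff]
      refine ⟨congrArg Subtype.val hx.apply_eq_smul, ?_⟩
      simpa using hx.2
    obtain ⟨E, _, _, T, hT, w₁, hw₁, hle₁⟩ := ih (f.restrict hmaps) heig hrank
    let π : V →ₗ[ℂ] LinearMap.ker φ :=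
      (LinearMap.id - φ.smulRight e).codRestrict _ (by simp [he])
    have hπ (x : V) : ((π x : LinearMap.ker φ) : V) = x - φ x • e := rfl
    have hπf (x : V) : π (f x) = f.restrict hmaps (π x) + φ x • π (f e) := by
      ext
      simp [hπ, hφf, he]
      module
    obtain ⟨w₂, hw₂, hw₂w⟩ := exists_between (max_lt hw₁ (hf z hz))
    obtain ⟨hw₁₂, hzw₂⟩ := max_lt_iff.mp hw₂
    set C := ‖T (π (f e))‖ with hC
    have h₁ : 0 < w₂ - w₁ := sub_pos.mpr hw₁₂
    have h₂ : 0 < w₂ - |z.im| := sub_pos.mpr hzw₂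
    obtain ⟨κ, hκ₀, hκ⟩ : ∃ κ : ℝ, κ ≠ 0 ∧ C ^ 2 ≤ 4 * (κ ^ 2 * (w₂ - |z.im|)) * (w₂ - w₁) := by
      refine ⟨Real.sqrt ((C ^ 2 + 1) / (4 * (w₂ - |z.im|) * (w₂ - w₁))), by positivity, ?_⟩
      rw [Real.sq_sqrt (by positivity)]
      field_simp
      linarith
    let T' : V →ₗ[ℂ] WithLp 2 (ℂ × E) :=
      (WithLp.linearEquiv 2 ℂ (ℂ × E)).symm.toLinearMap ∘ₗ ((κ : ℂ) • φ).prod (T ∘ₗ π)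
    have hfst (x : V) : (T' x).fst = κ * φ x := rfl
    have hsnd (x : V) : (T' x).snd = T (π x) := rfl
    refine ⟨WithLp 2 (ℂ × E), inferInstance, inferInstance, T', ?_, w₂, hw₂w, fun x ↦ ?_⟩
    · rw [injective_iff_map_eq_zero]
      intro x hx
      have hφx : φ x = 0 := by
        have := congrArg WithLp.fst hx
        simpa [hfst, hκ₀] using this
      have hπx : π x = 0 := by
        have := congrArg WithLp.snd hx
        rw [hsnd] at this
        exact (injective_iff_map_eq_zero T).mp hT _ this
      simpa [hφx, hπx] using (hπ x).symm
    · have hinner : inner ℂ (T' x) (T' (f x)) = ((κ ^ 2 * ‖φ x‖ ^ 2 : ℝ) : ℂ) * z +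
          (inner ℂ (T (π x)) (T (f.restrict hmaps (π x))) +
            φ x * inner ℂ (T (π x)) (T (π (f e)))) := by
        rw [WithLp.prod_inner_apply]
        change inner ℂ (T' x).fst (T' (f x)).fst + inner ℂ (T' x).snd (T' (f x)).snd = _
        rw [hfst, hfst, hsnd, hsnd, hπf, map_add, map_smul, inner_add_right, inner_smul_right,
          hφf, RCLike.inner_apply]
        push_cast
        rw [← Complex.conj_mul', map_mul, Complex.conj_ofReal]
        ring
      have hnorm : ‖T' x‖ ^ 2 = κ ^ 2 * ‖φ x‖ ^ 2 + ‖T (π x)‖ ^ 2 := by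
        rw [WithLp.prod_norm_sq_eq_of_L2, hfst, hsnd, norm_mul, Complex.norm_real, mul_pow,
          Real.norm_eq_abs, sq_abs]
      have hcross : |(φ x * inner ℂ (T (π x)) (T (π (f e)))).im| ≤ ‖φ x‖ * (‖T (π x)‖ * C) := by
        refine (Complex.abs_im_le_norm _).trans ?_
        rw [norm_mul]
        gcongr
        exact norm_inner_le_norm _ _
      have hyoung : ‖φ x‖ * (‖T (π x)‖ * C) ≤
          κ ^ 2 * (w₂ - |z.im|) * ‖φ x‖ ^ 2 + (w₂ - w₁) * ‖T (π x)‖ ^ 2 := by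
        nlinarith [sq_nonneg (C * ‖φ x‖ - 2 * (w₂ - w₁) * ‖T (π x)‖),
          mul_le_mul_of_nonneg_right hκ (sq_nonneg ‖φ x‖)]
      rw [hinner, hnorm, Complex.add_im, Complex.add_im, Complex.im_ofReal_mul]
      have hdiag : |κ ^ 2 * ‖φ x‖ ^ 2 * z.im| = κ ^ 2 * ‖φ x‖ ^ 2 * |z.im| := by
        rw [abs_mul, abs_of_nonneg (by positivity)]
      refine (abs_add_le _ _).trans ((add_le_add_right (abs_add_le _ _) _).trans ?_)
      rw [hdiag]
      linarith [hle₁ (π x)]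

/-- The quadratic form of the block matrix in `horizontal_strip_stable_iff_DH`, evaluated at
`(Q a, Q b)`. -/
theorem dotProduct_fromBlocks_mulVec {n : ℕ} (w : ℝ) {J R Q : Matrix (Fin n) (Fin n) ℝ}
    (hJ : Jᵀ = -J) (hR : Rᵀ = R) (hQ : Q.PosDef) (a b : Fin n → ℝ) :
    Sum.elim (Q *ᵥ a) (Q *ᵥ b) ⬝ᵥ
        (fromBlocks (w • Q⁻¹) (-J) J (w • Q⁻¹) *ᵥ Sum.elim (Q *ᵥ a) (Q *ᵥ b)) =
      w * (a ⬝ᵥ Q *ᵥ a + b ⬝ᵥ Q *ᵥ b) -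
        (((J - R) * Q) *ᵥ b ⬝ᵥ Q *ᵥ a - ((J - R) * Q) *ᵥ a ⬝ᵥ Q *ᵥ b) := by
  have hinv (x : Fin n → ℝ) : Q⁻¹ *ᵥ Q *ᵥ x = x := by
    rw [mulVec_mulVec, nonsing_inv_mul _ ((isUnit_iff_isUnit_det _).mp hQ.isUnit), one_mulVec]
  have hJ' (x y : Fin n → ℝ) : x ⬝ᵥ J *ᵥ y = -(J *ᵥ x ⬝ᵥ y) := by
    rw [dotProduct_mulVec, ← mulVec_transpose, hJ, neg_mulVec, neg_dotProduct]
  have hR' (x y : Fin n → ℝ) : R *ᵥ x ⬝ᵥ y = R *ᵥ y ⬝ᵥ x := by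
    rw [dotProduct_comm, dotProduct_mulVec, ← mulVec_transpose, hR]
  rw [fromBlocks_mulVec, sumElim_dotProduct_sumElim]
  simp only [Sum.elim_comp_inl, Sum.elim_comp_inr, smul_mulVec, hinv, neg_mulVec,
    dotProduct_add, dotProduct_neg, dotProduct_smul, smul_eq_mul, ← mulVec_mulVec, sub_mulVec,
    sub_dotProduct, hJ', dotProduct_comm _ a, dotProduct_comm _ b]
  rw [hR' (Q *ᵥ b)]
  have := hJ' (Q *ᵥ b) (Q *ᵥ a)
  rw [dotProduct_comm] at this
  linarith

/-- The block matrix in `horizontal_strip_stable_iff_DH` is positive definite iff the numerical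
range of `(J - R) * Q` in the inner product given by `Q` lies in the strip of half-width `w`. -/
theorem posDef_fromBlocks_iff {n : ℕ} (w : ℝ) {J R Q : Matrix (Fin n) (Fin n) ℝ}
    (hJ : Jᵀ = -J) (hR : Rᵀ = R) (hQ : Q.PosDef) :
    (fromBlocks (w • Q⁻¹) (-J) J (w • Q⁻¹)).PosDef ↔ ∀ a b : Fin n → ℝ, a ≠ 0 ∨ b ≠ 0 →
      ((J - R) * Q) *ᵥ b ⬝ᵥ Q *ᵥ a - ((J - R) * Q) *ᵥ a ⬝ᵥ Q *ᵥ b <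
        w * (a ⬝ᵥ Q *ᵥ a + b ⬝ᵥ Q *ᵥ b) := by
  have hdet := (isUnit_iff_isUnit_det _).mp hQ.isUnit
  have hinv (x : Fin n → ℝ) : Q⁻¹ *ᵥ Q *ᵥ x = x := by
    rw [mulVec_mulVec, nonsing_inv_mul _ hdet, one_mulVec]
  have hinv' (x : Fin n → ℝ) : Q *ᵥ Q⁻¹ *ᵥ x = x := by
    rw [mulVec_mulVec, mul_nonsing_inv _ hdet, one_mulVec]
  have hinj {x : Fin n → ℝ} (hx : Q *ᵥ x = 0) : x = 0 := by
    rw [← hinv x, hx, mulVec_zero]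
  constructor
  · intro h a b hab
    have hne : Sum.elim (Q *ᵥ a) (Q *ᵥ b) ≠ 0 := by
      intro h0
      have ha : Q *ᵥ a = 0 := funext fun i ↦ congrFun h0 (.inl i)
      have hb : Q *ᵥ b = 0 := funext fun i ↦ congrFun h0 (.inr i)
      exact hab.elim (· (hinj ha)) (· (hinj hb))
    have := h.dotProduct_mulVec_pos hne
    rw [star_trivial, dotProduct_fromBlocks_mulVec w hJ hR hQ] at this
    linarith
  · intro h
    refine PosDef.of_dotProduct_mulVec_pos ?_ fun x hx ↦ ?_
    · rw [isHermitian_fromBlocks_iff]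
      have hS : (w • Q⁻¹).IsHermitian := hQ.inv.isHermitian.smul (IsSelfAdjoint.all w)
      refine ⟨hS, ?_, ?_, hS⟩ <;> simp [conjTranspose_eq_transpose_of_trivial, hJ]
    · have hx' : x = Sum.elim (Q *ᵥ Q⁻¹ *ᵥ (x ∘ Sum.inl)) (Q *ᵥ Q⁻¹ *ᵥ (x ∘ Sum.inr)) := by
        rw [hinv', hinv', Sum.elim_comp_inl_inr]
      have hab : Q⁻¹ *ᵥ (x ∘ Sum.inl) ≠ 0 ∨ Q⁻¹ *ᵥ (x ∘ Sum.inr) ≠ 0 := by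
        by_contra! h0
        refine hx ?_
        rw [hx', h0.1, h0.2]
        ext i
        cases i <;> simp
      rw [star_trivial, hx', dotProduct_fromBlocks_mulVec w hJ hR hQ]
      linarith [h _ _ hab]

/-- A complex root of the characteristic polynomial of a real matrix has an eigenvector, written
here through its real and imaginary parts. -/
theorem exists_mulVec_eq_of_isRoot_charpoly {n : ℕ} {A : Matrix (Fin n) (Fin n) ℝ} {z : ℂ}
    (hz : ((A.map Complex.ofReal).charpoly).IsRoot z) :
    ∃ a b : Fin n → ℝ, (a ≠ 0 ∨ b ≠ 0) ∧
      A *ᵥ a = z.re • a - z.im • b ∧ A *ᵥ b = z.im • a + z.re • b := by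
  rw [← mem_spectrum_iff_isRoot_charpoly, ← spectrum_toLin',
    ← Module.End.hasEigenvalue_iff_mem_spectrum] at hz
  obtain ⟨v, hv⟩ := hz.exists_hasEigenvector
  have hAv := hv.apply_eq_smul
  refine ⟨fun i ↦ (v i).re, fun i ↦ (v i).im, ?_, ?_, ?_⟩
  · by_contra! h0
    exact hv.2 (funext fun i ↦ Complex.ext (congrFun h0.1 i) (congrFun h0.2 i))
  · ext i
    have := congrArg Complex.re (congrFun hAv i)
    simpa [mulVec, dotProduct] using this
  · ext i
    have := congrArg Complex.im (congrFun hAv i)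
    simpa [mulVec, dotProduct, add_comm] using this

/-- If all complex eigenvalues of `A` lie in the strip of half-width `w`, then so does its numerical
range for a suitable inner product. -/
theorem exists_posDef_of_charpoly_isRoot {n : ℕ} {w : ℝ} (hw : 0 < w)
    {A : Matrix (Fin n) (Fin n) ℝ}
    (hA : ∀ z : ℂ, ((A.map Complex.ofReal).charpoly).IsRoot z → |z.im| < w) :
    ∃ Q : Matrix (Fin n) (Fin n) ℝ, Q.PosDef ∧ ∀ a b : Fin n → ℝ, a ≠ 0 ∨ b ≠ 0 →
      A *ᵥ b ⬝ᵥ Q *ᵥ a - A *ᵥ a ⬝ᵥ Q *ᵥ b < w * (a ⬝ᵥ Q *ᵥ a + b ⬝ᵥ Q *ᵥ b) := by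
  have hf (z : ℂ) (hz : Module.End.HasEigenvalue (toLin' (A.map Complex.ofReal)) z) :
      |z.im| < w := by
    rw [Module.End.hasEigenvalue_iff_mem_spectrum, spectrum_toLin',
      mem_spectrum_iff_isRoot_charpoly] at hz
    exact hA z hz
  obtain ⟨E, _, _, T, hT, w', hw', hle⟩ := exists_embedding_abs_im_inner_le _ hw hf
  let ι : (Fin n → ℝ) →ₗ[ℝ] (Fin n → ℂ) := Complex.ofRealCLM.toLinearMap.compLeft (Fin n)
  let S : (Fin n → ℝ) →ₗ[ℝ] E := T.restrictScalars ℝ ∘ₗ ι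
  have hS : Function.Injective S :=
    hT.comp fun a b h ↦ funext fun i ↦ Complex.ofReal_injective (congrFun h i)
  have hSA (a : Fin n → ℝ) : T (toLin' (A.map Complex.ofReal) (ι a)) = S (A *ᵥ a) := by
    refine congrArg T (funext fun i ↦ ?_)
    simp [ι, mulVec, dotProduct]
  let Q : Matrix (Fin n) (Fin n) ℝ :=
    of fun i j ↦ (inner ℂ (S (Pi.single i 1)) (S (Pi.single j 1))).re
  have hQ (a b : Fin n → ℝ) : a ⬝ᵥ Q *ᵥ b = (inner ℂ (S a) (S b)).re := by
    have hsum (c : Fin n → ℝ) : S c = ∑ i, (c i : ℂ) • S (Pi.single i 1) := by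
      conv_lhs => rw [pi_eq_sum_univ' c, map_sum]
      simp
    have hinner : inner ℂ (S a) (S b) = ∑ i, ∑ j,
        ((a i * b j : ℝ) : ℂ) * inner ℂ (S (Pi.single i 1)) (S (Pi.single j 1)) := by
      rw [hsum a, hsum b, sum_inner]
      refine Finset.sum_congr rfl fun i _ ↦ ?_
      rw [inner_sum]
      refine Finset.sum_congr rfl fun j _ ↦ ?_
      rw [inner_smul_left, inner_smul_right, Complex.conj_ofReal]
      push_cast
      ring
    simp only [hinner, Complex.re_sum, Complex.re_ofReal_mul, dotProduct, mulVec, Q, of_apply,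
      Finset.mul_sum]
    exact Finset.sum_congr rfl fun i _ ↦ Finset.sum_congr rfl fun j _ ↦ by ring
  have hnorm (x : E) : ‖x‖ ^ 2 = (inner ℂ x x).re := (inner_self_eq_norm_sq (𝕜 := ℂ) x).symm
  have hpos {a : Fin n → ℝ} (ha : a ≠ 0) : 0 < a ⬝ᵥ Q *ᵥ a := by
    rw [hQ, ← hnorm]
    have : S a ≠ 0 := (map_ne_zero_iff S hS).mpr ha
    positivity
  have hQd : Q.PosDef := by
    refine PosDef.of_dotProduct_mulVec_pos ?_ fun x hx ↦ ?_
    · ext i j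
      exact inner_re_symm (𝕜 := ℂ) _ _
    · rw [star_trivial]
      exact hpos hx
  refine ⟨Q, hQd, fun a b hab ↦ ?_⟩
  have hsum_pos : 0 < a ⬝ᵥ Q *ᵥ a + b ⬝ᵥ Q *ᵥ b := by
    have hnonneg (c : Fin n → ℝ) : 0 ≤ c ⬝ᵥ Q *ᵥ c := by
      rw [hQ, ← hnorm]
      positivity
    rcases hab with ha | hb
    · exact add_pos_of_pos_of_nonneg (hpos ha) (hnonneg b)
    · exact add_pos_of_nonneg_of_pos (hnonneg a) (hpos hb)
  refine lt_of_le_of_lt ?_ (mul_lt_mul_of_pos_right hw' hsum_pos)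
  have hι (c : Fin n → ℝ) : T (ι c) = S c := rfl
  have h₁ := (abs_le.mp (hle (ι a + Complex.I • ι b))).2
  have h₂ := (abs_le.mp (hle (ι a - Complex.I • ι b))).1
  simp only [map_add, map_sub, map_smul, hSA, hι, hnorm, inner_add_left, inner_add_right,
    inner_sub_left, inner_sub_right, inner_smul_left, inner_smul_right, Complex.conj_I,
    Complex.add_im, Complex.add_re, Complex.sub_im, Complex.sub_re, Complex.mul_re, Complex.mul_im,
    Complex.neg_re, Complex.neg_im, Complex.I_re, Complex.I_im] at h₁ h₂
  have hsymm (x y : E) : (inner ℂ x y).re = (inner ℂ y x).re := inner_re_symm (𝕜 := ℂ) x y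
  rw [hQ, hQ, hQ, hQ, hsymm _ (S a), hsymm _ (S b)]
  linarith

/-- DH characterization of matrices with all eigenvalues in the horizontal strip
`{z : |Im z| < w}`. -/
theorem horizontal_strip_stable_iff_DH {n : ℕ} (w : ℝ) (hw : 0 < w)
    (A : Matrix (Fin n) (Fin n) ℝ) :
    (∀ z : ℂ, ((A.map Complex.ofReal).charpoly).IsRoot z → |z.im| < w)
    ↔ ∃ J R Q : Matrix (Fin n) (Fin n) ℝ, Jᵀ = -J ∧ Rᵀ = R ∧ Q.PosDef ∧
        A = (J - R) * Q ∧
        (Matrix.fromBlocks (w • Q⁻¹) (-J) J (w • Q⁻¹)).PosDef := by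
  constructor
  · intro hA
    obtain ⟨Q, hQ, hAQ⟩ := exists_posDef_of_charpoly_isRoot hw hA
    have hP : Q⁻¹ᵀ = Q⁻¹ := hQ.inv.isHermitian
    have hdet := (isUnit_iff_isUnit_det _).mp hQ.isUnit
    set J : Matrix (Fin n) (Fin n) ℝ := (2⁻¹ : ℝ) • (A * Q⁻¹ - Q⁻¹ * Aᵀ) with hJdef
    set R : Matrix (Fin n) (Fin n) ℝ := -((2⁻¹ : ℝ) • (A * Q⁻¹ + Q⁻¹ * Aᵀ)) with hRdef
    have hJ : Jᵀ = -J := by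
      rw [hJdef, transpose_smul, transpose_sub, transpose_mul, transpose_mul, hP,
        transpose_transpose, ← smul_neg, neg_sub]
    have hR : Rᵀ = R := by
      rw [hRdef, transpose_neg, transpose_smul, transpose_add, transpose_mul, transpose_mul, hP,
        transpose_transpose, add_comm]
    have hAJR : A = (J - R) * Q := by
      have : J - R = A * Q⁻¹ := by
        rw [hJdef, hRdef]
        module
      rw [this, nonsing_inv_mul_cancel_right _ _ hdet]
    refine ⟨J, R, Q, hJ, hR, hQ, hAJR, (posDef_fromBlocks_iff w hJ hR hQ).mpr ?_⟩
    rwa [← hAJR]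
  · rintro ⟨J, R, Q, hJ, hR, hQ, hAJR, hblock⟩ z hz
    rw [posDef_fromBlocks_iff w hJ hR hQ, ← hAJR] at hblock
    obtain ⟨a, b, hab, ha, hb⟩ := exists_mulVec_eq_of_isRoot_charpoly hz
    have hnonneg (c : Fin n → ℝ) : 0 ≤ c ⬝ᵥ Q *ᵥ c := by
      simpa using hQ.posSemidef.dotProduct_mulVec_nonneg c
    have hsymm : b ⬝ᵥ Q *ᵥ a = a ⬝ᵥ Q *ᵥ b := by
      have hQT : Qᵀ = Q := hQ.isHermitian
      rw [dotProduct_mulVec, ← mulVec_transpose, hQT, dotProduct_comm]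
    have h₁ := hblock a b hab
    have h₂ := hblock a (-b) (by simpa using hab)
    simp only [mulVec_neg, ha, hb, neg_dotProduct, dotProduct_neg, add_dotProduct, sub_dotProduct,
      smul_dotProduct, smul_eq_mul, hsymm] at h₁ h₂
    rw [abs_lt]
    constructor <;> nlinarith [hnonneg a, hnonneg b]
end

section
/- Let Ω ⊆ ℂ be an extended LMI region determined by a complex Hermitian m×m matrix B and a complex m×m matrix C. A complex n×n matrix A has all of its eigenvalues in Ω if and only if A = (J − R)Q for some complex n×n matrices J, R, Q with J* = −J, R* = R, Q Hermitian positive definite, and such that the complex Hermitian nm×nm matrix B ⊗ Q⁻¹ + (C − C*) ⊗ J − (C + C*) ⊗ R is negative definite (⊗ is the Kronecker product, and * denotes the conjugate transpose). -/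
open Matrix Kronecker
open scoped ComplexOrder

open Topology Filter

namespace Matrix

section Perturbation

variable {ι : Type*} [Fintype ι]

/-- Positive definiteness is an open condition among Hermitian matrices. -/
theorem PosDef.eventually_nhds {F : Matrix ι ι ℂ} (hF : F.PosDef) :
    ∀ᶠ G in 𝓝 F, G.IsHermitian → G.PosDef := by
  have key : ∀ᶠ G in 𝓝 F, ∀ x ∈ Metric.sphere (0 : ι → ℂ) 1,
      0 < (star x ⬝ᵥ (G *ᵥ x)).re := by
    refine (isCompact_sphere (0 : ι → ℂ) 1).eventually_forall_of_forall_eventually fun x hx => ?_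
    have hx0 : x ≠ 0 := by
      rintro rfl
      simp at hx
    have hc : Continuous fun p : Matrix ι ι ℂ × (ι → ℂ) =>
        (star p.2 ⬝ᵥ (p.1 *ᵥ p.2)).re :=
      Complex.continuous_re.comp <|
        continuous_snd.star.dotProduct (continuous_fst.matrix_mulVec continuous_snd)
    exact hc.continuousAt.eventually (lt_mem_nhds (hF.re_dotProduct_pos hx0))
  filter_upwards [key] with G hG hGH
  refine .of_dotProduct_mulVec_pos hGH fun x hx => ?_
  have hn : 0 < ‖x‖ := norm_pos_iff.2 hx
  have h1 := hG (((‖x‖⁻¹ : ℝ) : ℂ) • x) (by simp [norm_smul, hn.ne'])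
  have h2 : (star (((‖x‖⁻¹ : ℝ) : ℂ) • x) ⬝ᵥ (G *ᵥ (((‖x‖⁻¹ : ℝ) : ℂ) • x))).re
      = (‖x‖⁻¹ * ‖x‖⁻¹) * (star x ⬝ᵥ (G *ᵥ x)).re := by
    rw [star_smul, mulVec_smul, smul_dotProduct, dotProduct_smul, smul_smul, RCLike.star_def,
      Complex.conj_ofReal, ← Complex.ofReal_mul, smul_eq_mul, Complex.re_ofReal_mul]
  rw [h2] at h1
  refine RCLike.pos_iff.2 ⟨pos_of_mul_pos_right h1 (by positivity), ?_⟩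
  exact hGH.im_star_dotProduct_mulVec_self x

end Perturbation

/-- A block diagonal matrix with positive definite blocks is positive definite. -/
theorem PosDef.blockDiagonal {κ ι : Type*} [Fintype κ] [Fintype ι] [DecidableEq ι]
    {F : ι → Matrix κ κ ℂ} (hF : ∀ i, (F i).PosDef) : (blockDiagonal F).PosDef := by
  refine .of_dotProduct_mulVec_pos ?_ fun x hx => ?_
  · rw [IsHermitian, blockDiagonal_conjTranspose]
    exact congrArg _ (funext fun i => (hF i).isHermitian)
  have h : star x ⬝ᵥ (Matrix.blockDiagonal F *ᵥ x) =
      ∑ i, star (fun a => x (a, i)) ⬝ᵥ (F i *ᵥ fun a => x (a, i)) := by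
    simp only [dotProduct, mulVec, Fintype.sum_prod_type_right, blockDiagonal_apply]
    simp
  rw [h]
  obtain ⟨⟨a, i⟩, hai⟩ := Function.ne_iff.1 hx
  refine Finset.sum_pos' (fun i _ => (hF i).posSemidef.dotProduct_mulVec_nonneg _)
    ⟨i, Finset.mem_univ _, (hF i).dotProduct_mulVec_pos fun h0 => hai ?_⟩
  simpa using congrFun h0 a

section Similar

/-- The set of matrices similar to `A`. -/
def similarSet {ι : Type*} [Fintype ι] [DecidableEq ι] (A : Matrix ι ι ℂ) :
    Set (Matrix ι ι ℂ) :=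
  {M | ∃ P : Matrix ι ι ℂ, IsUnit P ∧ A * P = P * M}

theorem fromBlocks_mem_closure_similarSet {α β : Type*} [Fintype α] [DecidableEq α] [Fintype β]
    [DecidableEq β] {A D : Matrix α α ℂ} (b : Matrix β α ℂ) (Z : Matrix β β ℂ)
    (hD : D ∈ closure (similarSet A)) :
    fromBlocks D 0 0 Z ∈ closure (similarSet (fromBlocks A 0 b Z)) := by
  rw [← closure_closure]
  refine map_mem_closure (f := fun M => fromBlocks M 0 0 Z)
    (continuous_id.matrix_fromBlocks continuous_const continuous_const continuous_const) hD ?_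
  rintro M ⟨P, hP, hAP⟩
  have h0 : (0 : ℂ) ∈ closure {0}ᶜ := by simp
  have hcont : Continuous fun s : ℂ => fromBlocks M 0 (s • (b * P)) Z :=
    continuous_const.matrix_fromBlocks continuous_const (by fun_prop) continuous_const
  have := map_mem_closure (t := similarSet (fromBlocks A 0 b Z)) hcont h0 ?_
  · simpa using this
  intro s hs
  have hs : s ≠ 0 := hs
  refine ⟨fromBlocks P 0 0 (s⁻¹ • 1), ?_, ?_⟩
  · rw [isUnit_iff_isUnit_det] at hP ⊢
    rw [det_fromBlocks_zero₁₂, det_smul, det_one, mul_one]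
    exact hP.mul (by simp [hs])
  · simp [fromBlocks_multiply, hAP, hs]

/-- Every complex matrix has a diagonal matrix of eigenvalues in the closure of its similarity
class. -/
theorem exists_diagonal_mem_closure_similarSet (n : ℕ) :
    ∀ {ι : Type} [Fintype ι] [DecidableEq ι], Fintype.card ι = n → ∀ A : Matrix ι ι ℂ,
      ∃ d : ι → ℂ, (∀ i, A.charpoly.IsRoot (d i)) ∧ diagonal d ∈ closure (similarSet A) := by
  induction n with
  | zero =>
    intro ι _ _ hι A
    have := Fintype.card_eq_zero_iff.1 hι
    exact ⟨0, isEmptyElim, subset_closure ⟨1, isUnit_one, Subsingleton.elim _ _⟩⟩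
  | succ n ih =>
    intro ι _ _ hι A
    have : Nonempty ι := Fintype.card_pos_iff.1 (by omega)
    obtain ⟨z, hz⟩ := Module.End.exists_eigenvalue (toLin' A)
    have hzroot : A.charpoly.IsRoot z := by
      simpa using (Module.End.hasEigenvalue_iff_isRoot_charpoly _ _).1 hz
    obtain ⟨v, hv⟩ := hz.exists_hasEigenvector
    have hAv : A *ᵥ v = z • v := by simpa using hv.apply_eq_smul
    obtain ⟨j, hj⟩ := Function.ne_iff.1 hv.2
    set S : Matrix ι ι ℂ := updateCol 1 j v with hS
    have hSdet : IsUnit S.det := by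
      rw [hS, ← cramer_apply, cramer_one]
      simpa using hj
    have hSunit : IsUnit S := (isUnit_iff_isUnit_det _).2 hSdet
    have hScol : S *ᵥ Pi.single j 1 = v := by
      ext i
      simp [hS]
    set A' := S⁻¹ * A * S with hA'
    have hSA' : S * A' = A * S := by
      rw [hA', mul_assoc, mul_nonsing_inv_cancel_left _ _ hSdet]
    have hcol : ∀ i, A' i j = (z • (Pi.single j 1 : ι → ℂ)) i := by
      intro i
      have h1 : A' *ᵥ Pi.single j 1 = z • Pi.single j 1 := by
        rw [hA', ← mulVec_mulVec, hScol, ← mulVec_mulVec, hAv, mulVec_smul, ← hScol,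
          mulVec_mulVec, nonsing_inv_mul _ hSdet, one_mulVec]
      have := congrFun h1 i
      simpa using this
    have hA'char : A'.charpoly = A.charpoly := by
      obtain ⟨U, hU⟩ := hSunit
      have := charpoly_units_conj' U A
      rwa [hU] at this
    let e := Equiv.sumCompl (fun x : ι => x ≠ j)
    set T := A'.submatrix e e with hT
    have hTchar : T.charpoly = A.charpoly := by
      rw [← hA'char]
      exact charpoly_reindex e.symm A'
    have hTblocks : T = fromBlocks T.toBlocks₁₁ 0 T.toBlocks₂₁ (diagonal fun _ => z) := by
      conv_lhs => rw [← fromBlocks_toBlocks T]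
      congr 1
      · ext ⟨i, hi⟩ ⟨k, hk⟩
        obtain rfl : k = j := not_not.1 hk
        simp [hT, e, toBlocks₁₂, hcol, hi]
      · ext ⟨i, hi⟩ ⟨k, hk⟩
        obtain rfl : k = j := not_not.1 hk
        obtain rfl : i = k := not_not.1 hi
        simp [hT, e, toBlocks₂₂, hcol]
    obtain ⟨d, hd, hdc⟩ := ih (ι := {x : ι // x ≠ j}) (by
      simp [Fintype.card_subtype_compl, hι]) T.toBlocks₁₁
    refine ⟨Sum.elim d (fun _ => z) ∘ e.symm, fun i => ?_, ?_⟩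
    · obtain ⟨i, rfl⟩ := e.surjective i
      rcases i with i | i
      · simp only [Function.comp_apply, Equiv.symm_apply_apply, Sum.elim_inl]
        rw [← hTchar, hTblocks, charpoly_fromBlocks_zero₁₂]
        exact Polynomial.root_mul_right_of_isRoot _ (hd i)
      · simpa using hzroot
    · have hmem := fromBlocks_mem_closure_similarSet T.toBlocks₂₁ (diagonal fun _ => z) hdc
      rw [← hTblocks, fromBlocks_diagonal] at hmem
      have := map_mem_closure (t := similarSet A)
        (f := fun M : Matrix _ _ ℂ => M.submatrix e.symm e.symm)
        (continuous_id.matrix_submatrix _ _) hmem ?_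
      · simpa [submatrix_diagonal_equiv] using this
      rintro M ⟨P, hP, hTP⟩
      refine ⟨S * P.submatrix e.symm e.symm, hSunit.mul ?_, ?_⟩
      · rw [isUnit_iff_isUnit_det] at hP ⊢
        rwa [det_submatrix_equiv_self]
      · have h2 : A' * P.submatrix e.symm e.symm
            = P.submatrix e.symm e.symm * M.submatrix e.symm e.symm := by
          rw [submatrix_mul_equiv, ← hTP, ← submatrix_mul_equiv (e₂ := e.symm)]
          simp [hT]
        rw [← mul_assoc, ← hSA', mul_assoc, h2, mul_assoc]

end Similar

section LMI

variable {κ ι : Type*}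

/-- The LMI matrix attached to `(B, C)` at a pair `(X, Y)`, where `Y` plays the role of `A X`. -/
def lmi (B C : Matrix κ κ ℂ) (X Y : Matrix ι ι ℂ) : Matrix (κ × ι) (κ × ι) ℂ :=
  -(B ⊗ₖ X + C ⊗ₖ Y + Cᴴ ⊗ₖ Yᴴ)

theorem isHermitian_lmi {B : Matrix κ κ ℂ} (hB : B.IsHermitian) (C : Matrix κ κ ℂ)
    {X : Matrix ι ι ℂ} (hX : X.IsHermitian) (Y : Matrix ι ι ℂ) : (lmi B C X Y).IsHermitian := by
  simp only [IsHermitian, lmi, conjTranspose_neg, conjTranspose_add, conjTranspose_kronecker,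
    conjTranspose_conjTranspose, hB.eq, hX.eq]
  abel

theorem lmi_conj [Fintype κ] [DecidableEq κ] [Fintype ι] (B C : Matrix κ κ ℂ) (X Y : Matrix ι ι ℂ) {ι' : Type*}
    (P : Matrix ι' ι ℂ) :
    ((1 : Matrix κ κ ℂ) ⊗ₖ P) * lmi B C X Y * ((1 : Matrix κ κ ℂ) ⊗ₖ P)ᴴ = lmi B C (P * X * Pᴴ) (P * Y * Pᴴ) := by
  simp [lmi, Matrix.mul_add, Matrix.add_mul, conjTranspose_kronecker, ← mul_kronecker_mul,
    Matrix.mul_assoc]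

theorem lmi_one_diagonal [DecidableEq ι] (B C : Matrix κ κ ℂ) (d : ι → ℂ) :
    lmi B C 1 (diagonal d) =
      blockDiagonal fun i => -(B + d i • C + (starRingEnd ℂ (d i)) • Cᴴ) := by
  rw [lmi, ← diagonal_one, diagonal_conjTranspose, kronecker_diagonal, kronecker_diagonal,
    kronecker_diagonal, ← blockDiagonal_add, ← blockDiagonal_add, ← blockDiagonal_neg]
  congr 1
  ext i : 1
  simp

theorem lmi_eq_of_sub_eq (B C : Matrix κ κ ℂ) {X Y J R : Matrix ι ι ℂ} (hJ : Jᴴ = -J)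
    (hR : Rᴴ = R) (hY : J - R = Y) :
    -(B ⊗ₖ X + (C - Cᴴ) ⊗ₖ J - (C + Cᴴ) ⊗ₖ R) = lmi B C X Y := by
  subst hY
  ext ⟨a, i⟩ ⟨b, j⟩
  simp [lmi, hJ, hR, kroneckerMap_apply]
  ring

end LMI

end Matrix

/-- DH characterization of complex Ω-stable matrices for an extended LMI region:
`A` is complex Ω-stable iff `A = (J - R) Q` with `J* = -J`, `R* = R`, `Q ≻ 0`, and
`B ⊗ Q⁻¹ + (C - C*) ⊗ J - (C + C*) ⊗ R ≺ 0`. -/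
theorem extended_lmi_region_DH_characterization {m n : ℕ}
    (B C : Matrix (Fin m) (Fin m) ℂ) (hB : B.IsHermitian)
    (A : Matrix (Fin n) (Fin n) ℂ) :
    (∀ z : ℂ, (A.charpoly).IsRoot z →
      (-(B + z • C + (starRingEnd ℂ z) • Cᴴ)).PosDef)
    ↔ ∃ J R Q : Matrix (Fin n) (Fin n) ℂ, Jᴴ = -J ∧ Rᴴ = R ∧ Q.PosDef ∧
        A = (J - R) * Q ∧
        (-(B ⊗ₖ Q⁻¹ + (C - Cᴴ) ⊗ₖ J - (C + Cᴴ) ⊗ₖ R)).PosDef := by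
  constructor
  · intro h
    obtain ⟨d, hd, hdc⟩ := exists_diagonal_mem_closure_similarSet n (Fintype.card_fin n) A
    have hpd : (lmi B C 1 (diagonal d)).PosDef := by
      rw [lmi_one_diagonal]
      exact .blockDiagonal fun i => h _ (hd i)
    have hcont : Continuous fun M : Matrix (Fin n) (Fin n) ℂ => lmi B C 1 M := by
      refine continuous_matrix fun p q => ?_
      simp only [lmi, Matrix.neg_apply, Matrix.add_apply, kroneckerMap_apply, conjTranspose_apply]
      fun_prop
    obtain ⟨M, ⟨P, hP, hAP⟩, hM⟩ := ((mem_closure_iff_frequently.1 hdc).and_eventually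
      (hcont.continuousAt.eventually hpd.eventually_nhds)).exists
    replace hM := hM (isHermitian_lmi hB C isHermitian_one M)
    have hPdet := (isUnit_iff_isUnit_det _).1 hP
    have hX : (P * Pᴴ).PosDef :=
      .mul_conjTranspose_self P (vecMul_injective_iff_isUnit.2 hP)
    have hXdet := (isUnit_iff_isUnit_det _).1 hX.isUnit
    have hY : P * M * Pᴴ = A * (P * Pᴴ) := by rw [← hAP, mul_assoc]
    set X := P * Pᴴ
    set Y := P * M * Pᴴ
    have hJ : ((1 / 2 : ℂ) • (Y - Yᴴ))ᴴ = -((1 / 2 : ℂ) • (Y - Yᴴ)) := by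
      simp [conjTranspose_smul, ← smul_neg]
    have hR : (-(1 / 2 : ℂ) • (Y + Yᴴ))ᴴ = -(1 / 2 : ℂ) • (Y + Yᴴ) := by
      simp [conjTranspose_smul, add_comm]
    have hJR : (1 / 2 : ℂ) • (Y - Yᴴ) - -(1 / 2 : ℂ) • (Y + Yᴴ) = Y := by
      module
    refine ⟨_, _, X⁻¹, hJ, hR, hX.inv, ?_, ?_⟩
    · rw [hJR, hY, mul_nonsing_inv_cancel_right _ _ hXdet]
    · rw [nonsing_inv_nonsing_inv _ hXdet, lmi_eq_of_sub_eq B C hJ hR hJR]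
      have h1 := lmi_conj B C 1 M P
      rw [mul_one] at h1
      rw [← h1]
      refine hM.mul_mul_conjTranspose_same (vecMul_injective_iff_isUnit.2 ?_)
      rw [isUnit_iff_isUnit_det, det_kronecker]
      simpa using fun h => absurd h hPdet.ne_zero
  · rintro ⟨J, R, Q, hJ, hR, hQ, hA, hpd⟩ z hz
    have hQdet := (isUnit_iff_isUnit_det _).1 hQ.isUnit
    have hY : J - R = A * Q⁻¹ := by rw [hA, mul_nonsing_inv_cancel_right _ _ hQdet]
    rw [lmi_eq_of_sub_eq B C hJ hR hY] at hpd
    obtain ⟨v, hv, hvA⟩ : ∃ v ≠ 0, v ᵥ* A = z • v := by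
      have : (scalar (Fin n) z - A).det = 0 := by rwa [← eval_charpoly]
      obtain ⟨v, hv, h⟩ := exists_vecMul_eq_zero_iff.2 this
      refine ⟨v, hv, ?_⟩
      rw [vecMul_sub, sub_eq_zero] at h
      rw [← h]
      simp [scalar_apply]
    let V : Matrix Unit (Fin n) ℂ := replicateRow Unit v
    have hVA : V * A = z • V := by
      rw [← replicateRow_vecMul, hvA]
      rfl
    have hVinj : Function.Injective V.vecMul := by
      obtain ⟨i, hi : v i ≠ 0⟩ := Function.ne_iff.1 hv
      intro x y hxy
      ext ⟨⟩
      have := congrFun hxy i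
      simpa [V, vecMul, dotProduct, hi] using this
    have hr := hQ.inv.mul_mul_conjTranspose_same hVinj
    have hinj : Function.Injective (1 ⊗ₖ V : Matrix (Fin m × Unit) (Fin m × Fin n) ℂ).vecMul := by
      obtain ⟨i, hi : v i ≠ 0⟩ := Function.ne_iff.1 hv
      intro x y hxy
      ext ⟨a, ⟨⟩⟩
      have := congrFun hxy (a, i)
      simpa [V, vecMul, dotProduct, Fintype.sum_prod_type, one_apply, hi] using this
    have h1 := hpd.mul_mul_conjTranspose_same hinj
    rw [lmi_conj, ← Matrix.mul_assoc V A, hVA, Matrix.smul_mul, Matrix.smul_mul] at h1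
    set r := V * Q⁻¹ * Vᴴ
    have hr0 : 0 < r () () := hr.diag_pos
    have hrr : star (r () ()) = r () () := hr.isHermitian.apply _ _
    have h2 := (h1.submatrix (e := fun a : Fin m => (a, ())) fun a b h => by simpa using h).smul
      (inv_pos.2 hr0)
    convert h2 using 1
    ext a b
    simp [lmi, hrr, kroneckerMap_apply]
    field_simp
end

section
/- Let w > 0 and let J, R, Q be real n×n matrices with Jᵀ = −J, Rᵀ = R, and Q symmetric positive definite, and set A = (J − R)Q. If the complex Hermitian matrices w·Q⁻¹ − i·J and w·Q⁻¹ + i·J are both positive definite (real matrices viewed as complex matrices), then every complex eigenvalue λ of A satisfies |Im(λ)| < w. -/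
open Matrix
open scoped ComplexOrder

/-- If `A = (J - R) Q` is a DH matrix with `Jᵀ = -J`, `Rᵀ = R`, `Q ≻ 0`, and the Hermitian
matrices `w Q⁻¹ - iJ` and `w Q⁻¹ + iJ` are positive definite, then every eigenvalue `λ` of
`A` satisfies `|Im λ| < w`. -/
theorem DH_horizontal_strip_of_posDef {n : ℕ} (w : ℝ) (hw : 0 < w)
    (J R Q : Matrix (Fin n) (Fin n) ℝ)
    (hJ : Jᵀ = -J) (hR : Rᵀ = R) (hQ : Q.PosDef)
    (A : Matrix (Fin n) (Fin n) ℝ) (hA : A = (J - R) * Q)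
    (h1 : (w • (Q⁻¹.map Complex.ofReal) - Complex.I • (J.map Complex.ofReal)).PosDef)
    (h2 : (w • (Q⁻¹.map Complex.ofReal) + Complex.I • (J.map Complex.ofReal)).PosDef) :
    ∀ z : ℂ, ((A.map Complex.ofReal).charpoly).IsRoot z → |z.im| < w := by
  intro z hz
  obtain ⟨v, hv, hAv⟩ : ∃ v : Fin n → ℂ, v ≠ 0 ∧ A.map Complex.ofReal *ᵥ v = z • v := by
    rw [Polynomial.IsRoot, eval_charpoly, ← exists_mulVec_eq_zero_iff] at hz
    obtain ⟨v, hv, h⟩ := hz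
    refine ⟨v, hv, ?_⟩
    rw [sub_mulVec, sub_eq_zero] at h
    simpa [scalar_apply, ← smul_one_eq_diagonal, smul_mulVec] using h.symm
  have map_mul_ofReal (M N : Matrix (Fin n) (Fin n) ℝ) :
      (M * N).map Complex.ofReal = M.map Complex.ofReal * N.map Complex.ofReal :=
    Matrix.map_mul (f := Complex.ofRealHom)
  have hinv : Q⁻¹.map Complex.ofReal * Q.map Complex.ofReal = 1 := by
    rw [← map_mul_ofReal, nonsing_inv_mul _ ((isUnit_iff_isUnit_det _).1 hQ.isUnit)]
    simp
  obtain ⟨y, hy⟩ : ∃ y, y = Q.map Complex.ofReal *ᵥ v := ⟨_, rfl⟩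
  have hvy : Q⁻¹.map Complex.ofReal *ᵥ y = v := by
    rw [hy, mulVec_mulVec, hinv, one_mulVec]
  have hy0 : y ≠ 0 := by
    rintro rfl
    exact hv (by rw [← hvy, mulVec_zero])
  have hJR : J.map Complex.ofReal *ᵥ y - R.map Complex.ofReal *ᵥ y =
      z • (Q⁻¹.map Complex.ofReal *ᵥ y) := by
    rw [hvy, ← hAv, hA, map_mul_ofReal, ← mulVec_mulVec, ← hy, ← sub_mulVec,
      Matrix.map_sub _ Complex.ofReal_sub]
  have hRim : (star y ⬝ᵥ R.map Complex.ofReal *ᵥ y).im = 0 := by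
    refine IsHermitian.im_star_dotProduct_mulVec_self (𝕜 := ℂ) ?_ y
    ext i j
    simpa using congrFun (congrFun hR i) j
  have key := congrArg (star y ⬝ᵥ ·) hJR
  have p1 := h1.dotProduct_mulVec_pos hy0
  have p2 := h2.dotProduct_mulVec_pos hy0
  simp only [sub_mulVec, add_mulVec, smul_mulVec, dotProduct_sub, dotProduct_add,
    dotProduct_smul] at key p1 p2
  generalize star y ⬝ᵥ J.map Complex.ofReal *ᵥ y = a at *
  generalize star y ⬝ᵥ R.map Complex.ofReal *ᵥ y = b at *
  generalize star y ⬝ᵥ Q⁻¹.map Complex.ofReal *ᵥ y = p at *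
  simp only [Complex.lt_def, Complex.sub_re, Complex.sub_im, Complex.add_re, Complex.add_im,
    Complex.real_smul, smul_eq_mul, Complex.mul_re, Complex.mul_im, Complex.ofReal_re,
    Complex.ofReal_im, Complex.I_re, Complex.I_im, Complex.zero_re, Complex.zero_im] at p1 p2
  have him := congrArg Complex.im key
  simp only [Complex.sub_im, smul_eq_mul, Complex.mul_im, hRim] at him
  have hpim : p.im = 0 := by
    have : w * p.im = 0 := by linarith [p1.2, p2.2]
    exact (mul_eq_zero.1 this).resolve_left hw.ne'
  have hpre : 0 < p.re := pos_of_mul_pos_right (by linarith [p1.1, p2.1] : 0 < w * p.re) hw.le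
  rw [hpim] at him p1 p2
  rw [abs_lt]
  constructor <;> refine lt_of_mul_lt_mul_right ?_ hpre.le <;> linarith [p1.1, p2.1]
end

section
/- Let w > 0 and let A be a real n×n matrix that is semisimple (i.e. A is diagonalizable over ℂ) and every complex eigenvalue λ of A satisfies |Im(λ)| < w. Then A = (J − R)Q for some real n×n matrices J, R, Q with Jᵀ = −J, Rᵀ = R, Q symmetric positive definite, and such that the complex Hermitian matrices w·Q⁻¹ − i·J and w·Q⁻¹ + i·J are both positive definite (real matrices viewed as complex matrices). -/
open Matrix
open scoped ComplexOrder

namespace Matrix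

variable {n : Type*}

/-- A real matrix is positive definite if its complexification is. -/
theorem PosDef.of_map_ofReal [Finite n] {X : Matrix n n ℝ} (h : (X.map Complex.ofReal).PosDef) :
    X.PosDef := by
  have := Fintype.ofFinite n
  refine .of_dotProduct_mulVec_pos ?_ fun x hx => ?_
  · ext i j
    have := congrFun (congrFun h.1 i) j
    simpa using this
  · have hx' : (fun i => (x i : ℂ)) ≠ 0 := fun h0 => hx <| by
      ext i
      simpa using congrFun h0 i
    have := h.dotProduct_mulVec_pos hx'
    rw [← Complex.zero_lt_real]
    convert this using 1
    simp [dotProduct, mulVec]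

/-- The entrywise real part of a Hermitian matrix, viewed as a complex matrix, is the average of
the matrix and its transpose. -/
theorem IsHermitian.map_re_map_ofReal {H : Matrix n n ℂ} (hH : H.IsHermitian) :
    (H.map Complex.re).map Complex.ofReal = (1 / 2 : ℂ) • (H + Hᵀ) := by
  ext i j
  simp only [map_apply, smul_apply, add_apply, transpose_apply, smul_eq_mul]
  rw [← hH.apply j i, ← starRingEnd_apply, Complex.add_conj]
  push_cast
  ring

variable [Fintype n] [DecidableEq n]

/-- Congruence of a positive real diagonal matrix by an invertible matrix is positive definite. -/
theorem posDef_mul_diagonal_mul_conjTranspose {P : Matrix n n ℂ} (hP : IsUnit P) {c : n → ℝ}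
    (hc : ∀ i, 0 < c i) : (P * diagonal (fun i => (c i : ℂ)) * Pᴴ).PosDef :=
  (IsUnit.posDef_star_right_conjugate_iff hP).2 <|
    PosDef.diagonal fun i => Complex.zero_lt_real.2 (hc i)

end Matrix

/-- If `A` is a semisimple real matrix (diagonalizable over ℂ) whose eigenvalues all satisfy
`|Im λ| < w`, then `A = (J - R) Q` with `Jᵀ = -J`, `Rᵀ = R`, `Q ≻ 0`, and the Hermitian
matrices `w Q⁻¹ - iJ` and `w Q⁻¹ + iJ` are positive definite. -/
theorem semisimple_horizontal_strip_DH {n : ℕ} (w : ℝ) (hw : 0 < w)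
    (A : Matrix (Fin n) (Fin n) ℝ)
    (hsemisimple : ∃ P : Matrix (Fin n) (Fin n) ℂ,
      IsUnit P ∧ (P⁻¹ * A.map Complex.ofReal * P).IsDiag)
    (hstable : ∀ z : ℂ, ((A.map Complex.ofReal).charpoly).IsRoot z → |z.im| < w) :
    ∃ J R Q : Matrix (Fin n) (Fin n) ℝ, Jᵀ = -J ∧ Rᵀ = R ∧ Q.PosDef ∧
      A = (J - R) * Q ∧
      (w • (Q⁻¹.map Complex.ofReal) - Complex.I • (J.map Complex.ofReal)).PosDef ∧
      (w • (Q⁻¹.map Complex.ofReal) + Complex.I • (J.map Complex.ofReal)).PosDef := by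
  obtain ⟨P, hP, hD⟩ := hsemisimple
  set B := A.map Complex.ofReal with hB
  obtain ⟨d, hd⟩ : ∃ d, diagonal d = P⁻¹ * B * P := ⟨_, hD.diagonal_diag⟩
  have hdet := (isUnit_iff_isUnit_det P).1 hP
  have hBP : B * P = P * diagonal d := by
    rw [hd, Matrix.mul_assoc, mul_nonsing_inv_cancel_left _ _ hdet]
  have him (i) : |(d i).im| < w := by
    apply hstable
    have hchar : B.charpoly = (diagonal d).charpoly := by
      obtain ⟨U, rfl⟩ := hP
      rw [hd]
      exact (charpoly_units_conj' U B).symm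
    rw [hchar, charpoly_diagonal, Polynomial.IsRoot, Polynomial.eval_prod]
    exact Finset.prod_eq_zero (Finset.mem_univ i) (by simp)
  have hBt : Bᴴ = Bᵀ := by
    ext i j
    simp [hB]
  set H := P * Pᴴ with hH
  set K := P * diagonal (fun i => ((d i).im : ℂ)) * Pᴴ with hK
  have hHpos : H.PosDef := by
    simpa using posDef_mul_diagonal_mul_conjTranspose hP (c := fun _ => 1) fun _ => one_pos
  have hplus : ((w : ℂ) • H + K).PosDef := by
    convert posDef_mul_diagonal_mul_conjTranspose hP (c := fun i => w + (d i).im)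
      (fun i => by linarith [abs_lt.1 (him i)]) using 1
    have : diagonal (fun i => ((w + (d i).im : ℝ) : ℂ)) =
        (w : ℂ) • (1 : Matrix (Fin n) (Fin n) ℂ) + diagonal (fun i => ((d i).im : ℂ)) := by
      rw [smul_one_eq_diagonal, diagonal_add]
      simp
    rw [this, Matrix.mul_add, Matrix.add_mul]
    simp [hH, hK]
  have hminus : ((w : ℂ) • H - K).PosDef := by
    convert posDef_mul_diagonal_mul_conjTranspose hP (c := fun i => w - (d i).im)
      (fun i => by linarith [abs_lt.1 (him i)]) using 1
    have : diagonal (fun i => ((w - (d i).im : ℝ) : ℂ)) =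
        (w : ℂ) • (1 : Matrix (Fin n) (Fin n) ℂ) - diagonal (fun i => ((d i).im : ℂ)) := by
      rw [smul_one_eq_diagonal, diagonal_sub]
      simp
    rw [this, Matrix.mul_sub, Matrix.sub_mul]
    simp [hH, hK]
  have hcomm : B * H - H * Bᵀ = (2 * Complex.I) • K := by
    have h1 : B * H = P * diagonal d * Pᴴ := by rw [hH, ← Matrix.mul_assoc, hBP]
    have h2 : H * Bᵀ = P * (diagonal d)ᴴ * Pᴴ := by
      rw [← hBt, hH, Matrix.mul_assoc, ← conjTranspose_mul, hBP, conjTranspose_mul,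
        Matrix.mul_assoc]
    have h3 : diagonal d - (diagonal d)ᴴ =
        (2 * Complex.I) • diagonal (fun i => ((d i).im : ℂ)) := by
      rw [diagonal_conjTranspose, diagonal_sub, ← diagonal_smul]
      congr 1
      ext i
      simp only [Pi.star_apply, Pi.smul_apply, smul_eq_mul]
      rw [← starRingEnd_apply, Complex.sub_conj]
      push_cast
      ring
    rw [h1, h2, ← Matrix.sub_mul, ← Matrix.mul_sub, h3]
    simp [hK]
  have hcommT : B * Hᵀ - Hᵀ * Bᵀ = -((2 * Complex.I) • Kᵀ) := by
    rw [← transpose_smul, ← hcomm]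
    simp
  set X := H.map Complex.re with hX
  have hXc : X.map Complex.ofReal = (1 / 2 : ℂ) • (H + Hᵀ) := hHpos.1.map_re_map_ofReal
  have hhalf : (0 : ℂ) < 1 / 2 := by norm_num
  have hXpos : X.PosDef := .of_map_ofReal <| by
    rw [hXc]
    exact (hHpos.add hHpos.transpose).smul hhalf
  have hXt : Xᵀ = X := by simpa using hXpos.1.eq
  have hXdet : IsUnit X.det := (isUnit_iff_isUnit_det X).1 hXpos.isUnit
  set J := (1 / 2 : ℝ) • (A * X - X * Aᵀ) with hJ
  have hJc : J.map Complex.ofReal = (Complex.I / 2) • (K - Kᵀ) := by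
    have h1 : J.map Complex.ofReal =
        (1 / 2 : ℂ) • (B * X.map Complex.ofReal - X.map Complex.ofReal * Bᵀ) := by
      ext i j
      simp [hJ, hB, mul_apply]
    have h2 : B * (H + Hᵀ) - (H + Hᵀ) * Bᵀ = (2 * Complex.I) • (K - Kᵀ) := by
      rw [Matrix.mul_add, Matrix.add_mul, add_sub_add_comm, hcomm, hcommT, smul_sub,
        sub_eq_add_neg]
    rw [h1, hXc, Matrix.mul_smul, Matrix.smul_mul, ← smul_sub, h2, smul_smul, smul_smul]
    congr 1
    ring
  refine ⟨J, -((1 / 2 : ℝ) • (A * X + X * Aᵀ)), X⁻¹, ?_, ?_, hXpos.inv, ?_, ?_, ?_⟩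
  · rw [hJ, ← smul_neg, transpose_smul]
    simp [hXt]
  · rw [transpose_neg, transpose_smul]
    simp [hXt, add_comm]
  · have : J - -((1 / 2 : ℝ) • (A * X + X * Aᵀ)) = A * X := by
      rw [hJ]
      module
    rw [this, mul_nonsing_inv_cancel_right _ _ hXdet]
  · rw [nonsing_inv_nonsing_inv _ hXdet, hXc, hJc]
    convert (hplus.add hminus.transpose).smul hhalf using 1
    ext i j
    simp only [Matrix.sub_apply, Matrix.add_apply, Matrix.smul_apply, transpose_apply, smul_eq_mul,
      Complex.real_smul]
    linear_combination (-(1 / 2) * (K i j - K j i)) * Complex.I_mul_I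
  · rw [nonsing_inv_nonsing_inv _ hXdet, hXc, hJc]
    convert (hminus.add hplus.transpose).smul hhalf using 1
    ext i j
    simp only [Matrix.sub_apply, Matrix.add_apply, Matrix.smul_apply, transpose_apply, smul_eq_mul,
      Complex.real_smul]
    linear_combination ((1 / 2) * (K i j - K j i)) * Complex.I_mul_I
end
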